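/- arXiv:2507.04507 — 7 statements merged into one kernel-verified Lean document; each statement's English description precedes it below -/
import Mathlib

section
/- Let p, q be nonnegative integers. There exist a constant C > 0, a real ε > 0 and a natural number N (all depending only on p and q) such that the following holds: for every n ≥ N and every real sequence x_1, …, x_n with ∑_{k=1}^n x_k = 0, ∑_{k=1}^n x_k^2 = 1 and m³ := ∑_{k=1}^n (x_k² + 1/n)^{3/2} ≤ ε, and for every ξ ∈ ℝ, both |ξ|^p |∂_ξ^q( E[cos(n ξ ⟨x, S⟩)] − e^{−ξ²/2} )| ≤ C m³ and |ξ|^p |∂_ξ^q E[sin(n ξ ⟨x, S⟩)]| ≤ C m³, where S is a random vector uniformly distributed on the standard (n−1)-dimensional simplex Δ_{n−1} and ⟨x, S⟩ = ∑_{k=1}^n x_k S_k. -/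
open Real Finset MeasureTheory

/-- The characteristic function of `1 - T`, where `T` is a standard exponential variable. -/
noncomputable def expCharFun (u : ℂ) : ℂ := Complex.exp (Complex.I * u) / (1 + Complex.I * u)

theorem exp_neg_sub_sq_le {b : ℝ} (hb : |b| ≤ 1 / 2) : exp (-b) ≤ exp (b ^ 2) * (1 - b) := by
  obtain ⟨h1, h2⟩ := abs_le.1 hb
  have key : 1 ≤ exp (b + b ^ 2) * (1 - b) := by
    rcases le_total b 0 with h | h
    · have := add_one_le_exp (b + b ^ 2)
      nlinarith [mul_le_mul_of_nonneg_right this (by linarith : 0 ≤ 1 - b),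
        mul_nonneg (neg_nonneg.2 h) (sq_nonneg b)]
    · have := quadratic_le_exp_of_nonneg (by positivity : 0 ≤ b + b ^ 2)
      have h3 : 0 ≤ (1 - b) * (1 + b) ^ 2 / 2 - b := by nlinarith [mul_nonneg h (sub_nonneg.2 h2), mul_nonneg (mul_nonneg h h) (sub_nonneg.2 h2)]
      nlinarith [mul_le_mul_of_nonneg_right this (by linarith : 0 ≤ 1 - b),
        mul_nonneg (sq_nonneg b) h3]
  calc exp (-b) = exp (-b) * 1 := by ring
    _ ≤ exp (-b) * (exp (b + b ^ 2) * (1 - b)) := by gcongr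
    _ = exp (b ^ 2) * (1 - b) := by rw [← mul_assoc, ← exp_add]; ring_nf

theorem norm_one_add_I_mul_ge {u : ℂ} (hu : |u.im| ≤ 1 / 2) :
    (1 - u.im) * √(1 + u.re ^ 2 / 4) ≤ ‖1 + Complex.I * u‖ := by
  obtain ⟨h1, h2⟩ := abs_le.1 hu
  rw [Complex.norm_eq_sqrt_sq_add_sq]
  apply le_sqrt_of_sq_le
  rw [mul_pow, sq_sqrt (by positivity)]
  simp
  nlinarith [mul_nonneg (sq_nonneg u.re) (by nlinarith : 0 ≤ 4 - (1 - u.im) ^ 2)]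

theorem norm_expCharFun_le {u : ℂ} (hu : |u.im| ≤ 1 / 2) :
    ‖expCharFun u‖ ≤ exp (u.im ^ 2) * (√(1 + u.re ^ 2 / 4))⁻¹ := by
  obtain ⟨h1, h2⟩ := abs_le.1 hu
  have h3 := norm_one_add_I_mul_ge hu
  have h4 : 0 < √(1 + u.re ^ 2 / 4) := by positivity
  have h5 : 0 < (1 - u.im) * √(1 + u.re ^ 2 / 4) := mul_pos (by linarith) h4
  rw [expCharFun, norm_div, Complex.norm_exp, div_le_iff₀ (h5.trans_le h3)]
  have : (Complex.I * u).re = -u.im := by simp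
  rw [this]
  calc exp (-u.im) ≤ exp (u.im ^ 2) * (1 - u.im) := exp_neg_sub_sq_le hu
    _ = exp (u.im ^ 2) * (√(1 + u.re ^ 2 / 4))⁻¹ * ((1 - u.im) * √(1 + u.re ^ 2 / 4)) := by
      field_simp
    _ ≤ _ := by gcongr

theorem norm_exp_neg_sq_div_two (u : ℂ) :
    ‖Complex.exp (-u ^ 2 / 2)‖ = exp ((u.im ^ 2 - u.re ^ 2) / 2) := by
  rw [Complex.norm_exp]
  congr 1
  simp [pow_two]

theorem norm_exp_neg_sq_div_two_le (u : ℂ) :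
    ‖Complex.exp (-u ^ 2 / 2)‖ ≤ exp (u.im ^ 2) * (√(1 + u.re ^ 2 / 4))⁻¹ := by
  have h4 : 0 < √(1 + u.re ^ 2 / 4) := by positivity
  have h : √(1 + u.re ^ 2 / 4) ≤ exp (u.re ^ 2 / 2) := by
    apply sqrt_le_iff.2 ⟨(exp_pos _).le, ?_⟩
    rw [← exp_nat_mul]
    have := add_one_le_exp ((2 : ℕ) * (u.re ^ 2 / 2))
    push_cast at *
    nlinarith [sq_nonneg u.re]
  rw [norm_exp_neg_sq_div_two]
  calc exp ((u.im ^ 2 - u.re ^ 2) / 2) ≤ exp (u.im ^ 2 + -(u.re ^ 2 / 2)) :=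
        exp_le_exp.2 (by nlinarith [sq_nonneg u.im])
    _ = exp (u.im ^ 2) * (exp (u.re ^ 2 / 2))⁻¹ := by rw [exp_add, exp_neg]
    _ ≤ _ := by gcongr

theorem norm_expCharFun_sub_le {u : ℂ} (hu : |u.im| ≤ 1 / 2) :
    ‖expCharFun u - Complex.exp (-u ^ 2 / 2)‖ ≤ 8 * ‖u‖ ^ 3 := by
  obtain ⟨h1, h2⟩ := abs_le.1 hu
  rcases le_total ‖u‖ 1 with h | h
  · have hn : 1 / 2 ≤ ‖1 + Complex.I * u‖ := by
      refine le_trans ?_ (Complex.abs_re_le_norm _)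
      refine le_trans ?_ (le_abs_self _)
      simp
      linarith
    have hne : 1 + Complex.I * u ≠ 0 := by
      rw [← norm_pos_iff]; linarith
    have e1 : ‖Complex.exp (Complex.I * u) - (1 + Complex.I * u - u ^ 2 / 2)‖ ≤ ‖u‖ ^ 3 := by
      have := Complex.exp_bound (x := Complex.I * u) (by simpa using h) (n := 3) (by norm_num)
      simp only [Finset.sum_range_succ, Finset.sum_range_zero, norm_mul, Complex.norm_I, one_mul] at this
      norm_num [Nat.factorial, mul_pow] at this
      refine le_trans (le_of_eq ?_) (this.trans ?_)
      · congr 1; ring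
      · nlinarith [pow_nonneg (norm_nonneg u) 3]
    have e2 : ‖Complex.exp (-u ^ 2 / 2) - (1 - u ^ 2 / 2)‖ ≤ ‖u‖ ^ 3 := by
      have hs : ‖-u ^ 2 / 2‖ ≤ 1 := by
        simp; nlinarith [norm_nonneg u]
      have := Complex.exp_bound (x := -u ^ 2 / 2) hs (n := 2) (by norm_num)
      simp only [Finset.sum_range_succ, Finset.sum_range_zero, norm_neg, norm_div, norm_pow] at this
      norm_num [Nat.factorial] at this
      refine le_trans (le_of_eq ?_) (this.trans ?_)
      · congr 1; ring
      · have : ‖u‖ ^ 4 ≤ ‖u‖ ^ 3 := pow_le_pow_of_le_one (norm_nonneg _) h (by norm_num)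
        nlinarith [pow_nonneg (norm_nonneg u) 3]
    have hI : ‖1 + Complex.I * u‖ ≤ 2 := by
      refine (norm_add_le _ _).trans ?_
      simp; linarith
    have : expCharFun u - Complex.exp (-u ^ 2 / 2) =
        ((Complex.exp (Complex.I * u) - (1 + Complex.I * u - u ^ 2 / 2))
          - (1 + Complex.I * u) * (Complex.exp (-u ^ 2 / 2) - (1 - u ^ 2 / 2))
          + Complex.I * u ^ 3 / 2) / (1 + Complex.I * u) := by
      rw [expCharFun]
      field_simp
      ring
    rw [this, norm_div, div_le_iff₀ (by linarith)]
    have e3 : ‖Complex.I * u ^ 3 / 2‖ = ‖u‖ ^ 3 / 2 := by simp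
    have e4 := norm_add_le ((Complex.exp (Complex.I * u) - (1 + Complex.I * u - u ^ 2 / 2))
          - (1 + Complex.I * u) * (Complex.exp (-u ^ 2 / 2) - (1 - u ^ 2 / 2))) (Complex.I * u ^ 3 / 2)
    have e5 := norm_sub_le (Complex.exp (Complex.I * u) - (1 + Complex.I * u - u ^ 2 / 2))
          ((1 + Complex.I * u) * (Complex.exp (-u ^ 2 / 2) - (1 - u ^ 2 / 2)))
    rw [norm_mul (1 + Complex.I * u)] at e5
    have e6 : ‖1 + Complex.I * u‖ * ‖Complex.exp (-u ^ 2 / 2) - (1 - u ^ 2 / 2)‖ ≤ 2 * ‖u‖ ^ 3 := by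
      gcongr
    have e7 : 8 * ‖u‖ ^ 3 * (1 / 2) ≤ 8 * ‖u‖ ^ 3 * ‖1 + Complex.I * u‖ := by gcongr
    linarith [pow_nonneg (norm_nonneg u) 3]
  · have hD : exp (u.im ^ 2) * (√(1 + u.re ^ 2 / 4))⁻¹ ≤ 3 := by
      have : 1 ≤ √(1 + u.re ^ 2 / 4) := by
        apply le_sqrt_of_sq_le; nlinarith [sq_nonneg u.re]
      have h4 : exp (u.im ^ 2) ≤ 3 := by
        refine le_trans (exp_le_exp.2 (by nlinarith : u.im ^ 2 ≤ 1)) ?_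
        linarith [exp_one_lt_d9]
      calc _ ≤ exp (u.im ^ 2) * 1 := by gcongr; exact inv_le_one_of_one_le₀ this
        _ ≤ 3 := by linarith
    have := norm_sub_le (expCharFun u) (Complex.exp (-u ^ 2 / 2))
    have h6 := norm_expCharFun_le hu
    have h7 := norm_exp_neg_sq_div_two_le u
    have : 1 ≤ ‖u‖ ^ 3 := one_le_pow₀ h
    linarith

theorem norm_prod_sub_prod_le_sum {ι : Type*} [DecidableEq ι] (s : Finset ι) (A B : ι → ℂ)
    (D : ι → ℝ) (hA : ∀ i ∈ s, ‖A i‖ ≤ D i) (hB : ∀ i ∈ s, ‖B i‖ ≤ D i) :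
    ‖∏ i ∈ s, A i - ∏ i ∈ s, B i‖ ≤ ∑ i ∈ s, ‖A i - B i‖ * ∏ j ∈ s.erase i, D j := by
  induction s using Finset.induction_on with
  | empty => simp
  | insert a s ha ih =>
    have hD : ∀ i ∈ s, 0 ≤ D i := fun i hi => (norm_nonneg _).trans (hA i (mem_insert_of_mem hi))
    rw [prod_insert ha, prod_insert ha, sum_insert ha, erase_insert ha]
    have e : A a * ∏ i ∈ s, A i - B a * ∏ i ∈ s, B i =
      (A a - B a) * ∏ i ∈ s, B i + A a * (∏ i ∈ s, A i - ∏ i ∈ s, B i) := by ring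
    rw [e]
    refine (norm_add_le _ _).trans (add_le_add ?_ ?_)
    · rw [norm_mul, norm_prod]
      gcongr with i hi
      exact hB i (mem_insert_of_mem hi)
    · rw [norm_mul]
      calc ‖A a‖ * ‖∏ i ∈ s, A i - ∏ i ∈ s, B i‖
          ≤ D a * ∑ i ∈ s, ‖A i - B i‖ * ∏ j ∈ s.erase i, D j := by
            gcongr
            · exact (norm_nonneg _).trans (hA a (mem_insert_self _ _))
            · exact hA a (mem_insert_self _ _)
            · exact ih (fun i hi => hA i (mem_insert_of_mem hi))
                (fun i hi => hB i (mem_insert_of_mem hi))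
        _ = _ := by
          rw [mul_sum]
          refine sum_congr rfl fun i hi => ?_
          have hne : a ≠ i := fun h => ha (h ▸ hi)
          rw [erase_insert_of_ne hne, prod_insert (fun h => ha (mem_of_mem_erase h))]
          ring

theorem one_add_pow_le_prod {ι : Type*} (s : Finset ι) (y : ι → ℝ) (M : ℕ) (hM : 0 < M)
    (hy : ∀ i ∈ s, 0 ≤ y i) (hyM : ∀ i ∈ s, M * y i ≤ ∑ j ∈ s, y j) :
    (1 + (∑ i ∈ s, y i) / M) ^ M ≤ ∏ i ∈ s, (1 + y i) := by
  have hM' : (0 : ℝ) < M := by exact_mod_cast hM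
  have hprod : ∀ i ∈ s, (1 : ℝ) ≤ 1 + y i := fun i hi => by linarith [hy i hi]
  rcases (sum_nonneg hy).eq_or_lt with h | h
  · rw [← h]
    calc (1 + 0 / (M : ℝ)) ^ M = ∏ i ∈ s, (1 : ℝ) := by simp
      _ ≤ _ := prod_le_prod (fun _ _ => zero_le_one) hprod
  · set σ := ∑ i ∈ s, y i
    have hsum : ∑ i ∈ s, M * y i / σ = M := by
      rw [← sum_div, ← mul_sum]; exact mul_div_cancel_right₀ _ h.ne'
    have hσM : 0 < σ / M := div_pos h hM'
    rw [← rpow_natCast, ← hsum, rpow_sum_of_pos (by rw [hsum]; linarith)]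
    refine prod_le_prod (fun i _ => rpow_nonneg (by rw [hsum]; linarith) _) fun i hi => ?_
    have := rpow_one_add_le_one_add_mul_self (s := σ / M) (p := M * y i / σ)
      (by linarith) (div_nonneg (mul_nonneg hM'.le (hy i hi)) h.le) ((div_le_one h).2 (hyM i hi))
    refine (le_of_eq ?_).trans (this.trans (le_of_eq ?_))
    · simp [hsum]
    · field_simp

theorem sqrt_inv_sq_natCast {n : ℕ} : (√(n : ℝ))⁻¹ ^ 2 = 1 / n := by
  rw [inv_pow, sq_sqrt (Nat.cast_nonneg n), one_div]

theorem norm_pow_three_le {n : ℕ} (a τ : ℝ) (z : ℂ) (hz : |z.im| ≤ 1) :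
    ‖(τ : ℂ) * ((√n)⁻¹ : ℝ) - z * a‖ ^ 3 ≤
      (a ^ 2 + 1 / n) ^ ((3 : ℝ) / 2) * (1 + (τ ^ 2 + z.re ^ 2)) ^ 2 := by
  set u := (τ : ℂ) * ((√n)⁻¹ : ℝ) - z * a
  have hsn := sqrt_inv_sq_natCast (n := n)
  set s := (√(n : ℝ))⁻¹
  have hz2 : z.im ^ 2 ≤ 1 := by rw [← sq_abs]; nlinarith [abs_nonneg z.im]
  have h1 : ‖u‖ ^ 2 ≤ (a ^ 2 + 1 / n) * (1 + (τ ^ 2 + z.re ^ 2)) := by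
    rw [← hsn, Complex.sq_norm, Complex.normSq_apply]
    have e1 : u.re = τ * s - z.re * a := by simp [u, s, -Complex.ofReal_inv]
    have e2 : u.im = - (z.im * a) := by simp [u, -Complex.ofReal_inv]
    rw [e1, e2]
    nlinarith [sq_nonneg (τ * a + z.re * s), mul_nonneg (sq_nonneg a) (sub_nonneg.2 hz2), sq_nonneg s]
  have h0 : 0 ≤ a ^ 2 + 1 / (n : ℝ) := by positivity
  have e3 : ‖u‖ ^ 3 = (‖u‖ ^ 2) ^ ((3 : ℝ) / 2) := by
    rw [← rpow_natCast, ← rpow_natCast, ← rpow_mul (norm_nonneg _)]; norm_num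
  calc ‖u‖ ^ 3 = (‖u‖ ^ 2) ^ ((3 : ℝ) / 2) := e3
    _ ≤ ((a ^ 2 + 1 / n) * (1 + (τ ^ 2 + z.re ^ 2))) ^ ((3 : ℝ) / 2) :=
      rpow_le_rpow (by positivity) h1 (by norm_num)
    _ = (a ^ 2 + 1 / n) ^ ((3 : ℝ) / 2) * (1 + (τ ^ 2 + z.re ^ 2)) ^ ((3 : ℝ) / 2) :=
      mul_rpow h0 (by positivity)
    _ ≤ (a ^ 2 + 1 / n) ^ ((3 : ℝ) / 2) * (1 + (τ ^ 2 + z.re ^ 2)) ^ (2 : ℝ) := by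
      gcongr
      · nlinarith [sq_nonneg τ, sq_nonneg z.re]
      · norm_num
    _ = _ := by norm_cast

theorem norm_prod_expCharFun_sub_le {n : ℕ} (hn : 0 < n) {x : Fin n → ℝ} (hx0 : ∑ k, x k = 0)
    (hx1 : ∑ k, x k ^ 2 = 1) {L : ℕ} (hL : 2 ≤ L)
    (hδ : ∀ k, (2 * L : ℕ) * (x k ^ 2 + 1 / n) ≤ 1) {z : ℂ} (hz : |z.im| ≤ 1) (τ : ℝ) :
    ‖∏ k, expCharFun (τ * ((√n)⁻¹ : ℝ) - z * x k) - Complex.exp (-(τ ^ 2 + z ^ 2) / 2)‖ ≤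
      8 * exp 1 * (∑ k, (x k ^ 2 + 1 / n) ^ ((3 : ℝ) / 2)) * (1 + (τ ^ 2 + z.re ^ 2)) ^ 2 *
        (1 + (τ ^ 2 + z.re ^ 2) / (8 * L)) / (1 + (τ ^ 2 + z.re ^ 2) / (8 * L)) ^ L := by
  have hn' : (0 : ℝ) < n := by exact_mod_cast hn
  have hL' : (2 : ℝ) ≤ L := by exact_mod_cast hL
  have hsn := sqrt_inv_sq_natCast (n := n)
  have hz2 : z.im ^ 2 ≤ 1 := by rw [← sq_abs]; nlinarith [abs_nonneg z.im]
  set u : Fin n → ℂ := fun k => τ * ((√n)⁻¹ : ℝ) - z * x k with hu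
  set s := (√(n : ℝ))⁻¹
  set ρ := τ ^ 2 + z.re ^ 2 with hρ
  have hρ0 : 0 ≤ ρ := by positivity
  set Y := 1 + ρ / (8 * L) with hY
  have hY1 : 1 ≤ Y := by rw [hY]; have : 0 ≤ ρ / (8 * L) := by positivity
                         linarith
  have hre : ∀ k, (u k).re = τ * s - z.re * x k := fun k => by simp [hu, s, -Complex.ofReal_inv]
  have him : ∀ k, (u k).im = -(z.im * x k) := fun k => by simp [hu, s, -Complex.ofReal_inv]
  have hsums : ∑ k : Fin n, s ^ 2 = 1 := by
    rw [hsn]; simp; field_simp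
  have hsre : ∑ k, (u k).re ^ 2 = ρ := by
    have : ∀ k, (u k).re ^ 2 = τ ^ 2 * s ^ 2 - (2 * τ * s * z.re) * x k + z.re ^ 2 * x k ^ 2 :=
      fun k => by rw [hre]; ring
    simp_rw [this, sum_add_distrib, sum_sub_distrib, ← mul_sum, hsums, hx0, hx1]
    rw [hρ]; ring
  have hsim : ∑ k, (u k).im ^ 2 = z.im ^ 2 := by
    simp_rw [him, neg_sq, mul_pow, ← mul_sum, hx1, mul_one]
  have hsu : ∑ k, u k ^ 2 = τ ^ 2 + z ^ 2 := by
    have : ∀ k, u k ^ 2 = τ ^ 2 * (s ^ 2 : ℝ) - (2 * τ * s * z) * x k + z ^ 2 * (x k ^ 2 : ℝ) :=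
      fun k => by simp only [hu]; push_cast; ring
    simp_rw [this, sum_add_distrib, sum_sub_distrib, ← mul_sum, ← Complex.ofReal_sum, hsums, hx0, hx1]
    push_cast; ring
  have hxk : ∀ k, x k ^ 2 ≤ 1 / 4 := fun k => by
    have h1 := hδ k
    push_cast at h1
    have : (0 : ℝ) ≤ 1 / n := by positivity
    nlinarith [sq_nonneg (x k)]
  have himk : ∀ k, |(u k).im| ≤ 1 / 2 := fun k => by
    apply abs_le_of_sq_le_sq _ (by norm_num)
    rw [him]
    nlinarith [hxk k, sq_nonneg (x k), mul_nonneg (sq_nonneg (x k)) (sub_nonneg.2 hz2)]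
  have hrek : ∀ k, (2 * L : ℕ) * ((u k).re ^ 2) ≤ ρ := fun k => by
    have h1 : (u k).re ^ 2 ≤ (x k ^ 2 + 1 / n) * ρ := by
      rw [hre, ← hsn, hρ]; nlinarith [sq_nonneg (τ * x k + z.re * s)]
    calc (2 * L : ℕ) * ((u k).re ^ 2) ≤ (2 * L : ℕ) * ((x k ^ 2 + 1 / n) * ρ) := by gcongr
      _ = ((2 * L : ℕ) * (x k ^ 2 + 1 / n)) * ρ := by ring
      _ ≤ 1 * ρ := by gcongr; exact hδ k
      _ = ρ := one_mul _
  have hexp : Complex.exp (-(τ ^ 2 + z ^ 2) / 2) = ∏ k, Complex.exp (-u k ^ 2 / 2) := by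
    rw [← Complex.exp_sum, ← hsu, ← sum_div, ← sum_neg_distrib]
  set D : Fin n → ℝ := fun k => exp ((u k).im ^ 2) * (√(1 + (u k).re ^ 2 / 4))⁻¹ with hD
  have hprodY : Y ^ (2 * L) ≤ ∏ k, (1 + (u k).re ^ 2 / 4) := by
    have := one_add_pow_le_prod univ (fun k => (u k).re ^ 2 / 4) (2 * L) (by omega)
      (fun k _ => by positivity) (fun k _ => by
        rw [← sum_div, hsre]; have := hrek k; linarith)
    rw [← sum_div, hsre] at this
    refine (le_of_eq ?_).trans this
    rw [hY]; congr 2; push_cast; field_simp; ring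
  have hprodD : ∀ k, ∏ j ∈ univ.erase k, D j ≤ exp 1 * Y / Y ^ L := fun k => by
    have hDk : 0 < D k := by positivity
    have h1 : ∏ j ∈ univ.erase k, D j = (∏ j, D j) / D k := by
      rw [eq_div_iff hDk.ne', mul_comm, mul_prod_erase _ _ (mem_univ k)]
    have h2 : ∏ j, D j ≤ exp (z.im ^ 2) * (Y ^ L)⁻¹ := by
      rw [hD, prod_mul_distrib, ← exp_sum, hsim, prod_inv_distrib]
      gcongr
      rw [← Real.sqrt_prod _ (fun i _ => by positivity)]
      apply le_sqrt_of_sq_le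
      rw [← pow_mul, mul_comm L]; exact hprodY
    have h3 : 1 / D k ≤ Y := by
      have h4 : √(1 + (u k).re ^ 2 / 4) ≤ Y := by
        apply sqrt_le_iff.2 ⟨by linarith, ?_⟩
        have : (u k).re ^ 2 / 4 ≤ ρ / (8 * L) := by
          rw [div_le_div_iff₀ (by norm_num) (by positivity)]
          have := hrek k; push_cast at this; linarith
        nlinarith
      have h5 : 1 ≤ exp ((u k).im ^ 2) := one_le_exp (sq_nonneg _)
      rw [hD, one_div, mul_inv, inv_inv]
      calc _ ≤ 1 * √(1 + (u k).re ^ 2 / 4) := by gcongr; exact inv_le_one_of_one_le₀ h5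
        _ ≤ Y := by linarith
    have h6 : exp (z.im ^ 2) ≤ exp 1 := exp_le_exp.2 hz2
    calc ∏ j ∈ univ.erase k, D j = (∏ j, D j) * (1 / D k) := by rw [h1]; ring
      _ ≤ (exp 1 * (Y ^ L)⁻¹) * Y := by
        gcongr
        exact h2.trans (by gcongr)
      _ = _ := by ring
  rw [hexp]
  refine (norm_prod_sub_prod_le_sum univ _ _ D (fun k _ => norm_expCharFun_le (himk k))
    (fun k _ => norm_exp_neg_sq_div_two_le (u k))).trans ?_
  calc ∑ k, ‖expCharFun (u k) - Complex.exp (-u k ^ 2 / 2)‖ * ∏ j ∈ univ.erase k, D j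
      ≤ ∑ k, (8 * ((x k ^ 2 + 1 / n) ^ ((3 : ℝ) / 2) * (1 + ρ) ^ 2)) * (exp 1 * Y / Y ^ L) := by
        refine sum_le_sum fun k _ => mul_le_mul ?_ (hprodD k)
          (prod_nonneg fun j _ => by positivity) (by positivity)
        exact (norm_expCharFun_sub_le (himk k)).trans
          (mul_le_mul_of_nonneg_left (norm_pow_three_le (x k) τ z hz) (by norm_num))
    _ = _ := by rw [← sum_mul, ← mul_sum, ← sum_mul]; ring

/-- Pointwise bound with a rapidly decaying weight. -/
theorem exists_norm_prod_expCharFun_sub_le (p : ℕ) :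
    ∃ C > (0 : ℝ), ∃ ε > (0 : ℝ), ∀ n : ℕ, 0 < n → ∀ x : Fin n → ℝ,
      ∑ k, x k = 0 → ∑ k, x k ^ 2 = 1 →
      ∑ k, (x k ^ 2 + 1 / n) ^ ((3 : ℝ) / 2) ≤ ε → ∀ z : ℂ, |z.im| ≤ 1 → ∀ τ : ℝ,
      ‖∏ k, expCharFun (τ * ((√n)⁻¹ : ℝ) - z * x k) - Complex.exp (-(τ ^ 2 + z ^ 2) / 2)‖ ≤
        C * (∑ k, (x k ^ 2 + 1 / n) ^ ((3 : ℝ) / 2)) * (1 + τ ^ 2)⁻¹ * ((1 + z.re ^ 2) ^ p)⁻¹ := by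
  set L := p + 4 with hL
  refine ⟨8 * exp 1 * (8 * L) ^ (p + 3), by positivity,
    ((1 : ℝ) / (2 * L : ℕ)) ^ ((3 : ℝ) / 2), by positivity, ?_⟩
  intro n hn x hx0 hx1 hε z hz τ
  have hL' : (4 : ℝ) ≤ L := by rw [hL]; push_cast; linarith [Nat.cast_nonneg (α := ℝ) p]
  have hδ : ∀ k, (2 * L : ℕ) * (x k ^ 2 + 1 / n) ≤ 1 := fun k => by
    have h1 : (x k ^ 2 + 1 / n) ^ ((3 : ℝ) / 2) ≤ ((1 : ℝ) / (2 * L : ℕ)) ^ ((3 : ℝ) / 2) :=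
      (single_le_sum (f := fun k => (x k ^ 2 + 1 / (n : ℝ)) ^ ((3 : ℝ) / 2))
        (fun i _ => by positivity) (mem_univ k)).trans hε
    rw [rpow_le_rpow_iff (by positivity) (by positivity) (by norm_num), le_div_iff₀ (by positivity)] at h1
    linarith
  refine (norm_prod_expCharFun_sub_le hn hx0 hx1 (by omega) hδ hz τ).trans ?_
  set m := ∑ k, (x k ^ 2 + 1 / n) ^ ((3 : ℝ) / 2)
  have hm : 0 ≤ m := sum_nonneg fun i _ => by positivity
  set ρ := τ ^ 2 + z.re ^ 2 with hρ
  have hρ0 : 0 ≤ ρ := by positivity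
  set Y := 1 + ρ / (8 * L) with hY
  have hY0 : 0 < Y := by positivity
  have hYρ : 1 + ρ ≤ 8 * L * Y := by
    rw [hY, mul_add, mul_div_cancel₀ _ (by positivity)]; linarith
  have h1 : (1 + τ ^ 2) * (1 + z.re ^ 2) ^ p ≤ (1 + ρ) ^ (p + 1) := by
    rw [pow_succ' (1 + ρ)]
    gcongr <;> rw [hρ] <;> nlinarith [sq_nonneg τ, sq_nonneg z.re]
  have h2 : (1 + ρ) ^ 2 * ((1 + τ ^ 2) * (1 + z.re ^ 2) ^ p) ≤ (8 * L) ^ (p + 3) * Y ^ (p + 3) := by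
    rw [← mul_pow]
    calc _ ≤ (1 + ρ) ^ 2 * (1 + ρ) ^ (p + 1) := by gcongr
      _ = (1 + ρ) ^ (p + 3) := by ring
      _ ≤ _ := by gcongr
  rw [div_le_iff₀ (by positivity)]
  have e : 8 * exp 1 * (8 * L) ^ (p + 3) * m * (1 + τ ^ 2)⁻¹ * ((1 + z.re ^ 2) ^ p)⁻¹ * Y ^ L
    = 8 * exp 1 * m * Y * (((8 * L) ^ (p + 3) * Y ^ (p + 3)) / ((1 + τ ^ 2) * (1 + z.re ^ 2) ^ p)) := by
    rw [hL, show p + 4 = p + 3 + 1 from rfl, pow_succ Y]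
    field_simp
  rw [e]
  calc 8 * exp 1 * m * (1 + ρ) ^ 2 * Y = 8 * exp 1 * m * Y * (1 + ρ) ^ 2 := by ring
    _ ≤ _ := by
      gcongr
      rw [le_div_iff₀ (by positivity)]
      exact h2

theorem measurable_expCharFun : Measurable expCharFun := by
  unfold expCharFun
  fun_prop

/-- The Fourier integral which is proportional to the characteristic function of the simplex. -/
noncomputable def fourierProd {n : ℕ} (x : Fin n → ℝ) (z : ℂ) : ℂ :=
  ∫ τ : ℝ, ∏ k, expCharFun (τ * ((√n)⁻¹ : ℝ) - z * x k)

theorem exp_neg_add_sq_eq (τ : ℝ) (z : ℂ) :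
    Complex.exp (-(τ ^ 2 + z ^ 2) / 2) =
      (exp (-(1 / 2) * τ ^ 2) : ℝ) * Complex.exp (-z ^ 2 / 2) := by
  push_cast
  rw [← Complex.exp_add]
  congr 1
  ring

theorem exists_norm_fourierProd_sub_le (p : ℕ) :
    ∃ C > (0 : ℝ), ∃ ε > (0 : ℝ), ∀ n : ℕ, 0 < n → ∀ x : Fin n → ℝ,
      ∑ k, x k = 0 → ∑ k, x k ^ 2 = 1 →
      ∑ k, (x k ^ 2 + 1 / n) ^ ((3 : ℝ) / 2) ≤ ε → ∀ z : ℂ, |z.im| ≤ 1 →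
      Integrable (fun τ : ℝ => ∏ k, expCharFun (τ * ((√n)⁻¹ : ℝ) - z * x k)) ∧
      ‖fourierProd x z - √(2 * π) * Complex.exp (-z ^ 2 / 2)‖ ≤
        C * (∑ k, (x k ^ 2 + 1 / n) ^ ((3 : ℝ) / 2)) * ((1 + z.re ^ 2) ^ p)⁻¹ := by
  obtain ⟨C, hC, ε, hε, h⟩ := exists_norm_prod_expCharFun_sub_le p
  refine ⟨C * π, by positivity, ε, hε, fun n hn x hx0 hx1 hm z hz => ?_⟩
  have hb := h n hn x hx0 hx1 hm z hz
  set m := ∑ k, (x k ^ 2 + 1 / (n : ℝ)) ^ ((3 : ℝ) / 2)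
  have hgi : Integrable (fun τ : ℝ => Complex.exp (-(τ ^ 2 + z ^ 2) / 2)) := by
    simp_rw [exp_neg_add_sq_eq]
    exact ((integrable_exp_neg_mul_sq (by norm_num : (0 : ℝ) < 1 / 2)).ofReal).mul_const _
  have hgv : ∫ τ : ℝ, Complex.exp (-(τ ^ 2 + z ^ 2) / 2) = √(2 * π) * Complex.exp (-z ^ 2 / 2) := by
    simp_rw [exp_neg_add_sq_eq]
    rw [integral_mul_const, integral_complex_ofReal, integral_gaussian]
    congr 3
    ring_nf
  have hwi : Integrable (fun τ : ℝ => C * m * (1 + τ ^ 2)⁻¹ * ((1 + z.re ^ 2) ^ p)⁻¹) :=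
    (integrable_inv_one_add_sq.const_mul _).mul_const _
  have hmeas : Measurable (fun τ : ℝ => ∏ k, expCharFun (τ * ((√n)⁻¹ : ℝ) - z * x k)) :=
    Finset.measurable_prod _ fun k _ => measurable_expCharFun.comp (by fun_prop)
  have hdi : Integrable (fun τ : ℝ => ∏ k, expCharFun (τ * ((√n)⁻¹ : ℝ) - z * x k)
      - Complex.exp (-(τ ^ 2 + z ^ 2) / 2)) :=
    hwi.mono' (hmeas.aestronglyMeasurable.sub hgi.1) (Filter.Eventually.of_forall hb)
  have hi : Integrable (fun τ : ℝ => ∏ k, expCharFun (τ * ((√n)⁻¹ : ℝ) - z * x k)) := by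
    refine (hdi.add hgi).congr (Filter.Eventually.of_forall fun τ => ?_)
    simp only [Pi.add_apply, sub_add_cancel]
  refine ⟨hi, ?_⟩
  rw [fourierProd, ← hgv, ← integral_sub hi hgi]
  refine (norm_integral_le_of_norm_le hwi (Filter.Eventually.of_forall hb)).trans (le_of_eq ?_)
  rw [integral_mul_const, integral_const_mul, integral_univ_inv_one_add_sq]
  ring

theorem norm_exp_neg_sq_div_two_le_inv_pow (p : ℕ) {z : ℂ} (hz : |z.im| ≤ 1) :
    ‖Complex.exp (-z ^ 2 / 2)‖ ≤ p.factorial * 2 ^ p * exp 1 * ((1 + z.re ^ 2) ^ p)⁻¹ := by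
  have hz2 : z.im ^ 2 ≤ 1 := by rw [← sq_abs]; nlinarith [abs_nonneg z.im]
  rw [norm_exp_neg_sq_div_two]
  have h := pow_div_factorial_le_exp ((1 + z.re ^ 2) / 2) (by positivity) p
  rw [div_pow, div_le_iff₀ (by positivity), div_le_iff₀ (by positivity)] at h
  rw [← div_eq_mul_inv, le_div_iff₀ (by positivity)]
  calc exp ((z.im ^ 2 - z.re ^ 2) / 2) * (1 + z.re ^ 2) ^ p
      ≤ exp ((1 - z.re ^ 2) / 2) * (exp ((1 + z.re ^ 2) / 2) * p.factorial * 2 ^ p) := by gcongr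
    _ = p.factorial * 2 ^ p * (exp ((1 - z.re ^ 2) / 2) * exp ((1 + z.re ^ 2) / 2)) := by ring
    _ = _ := by rw [← exp_add]; ring_nf

theorem exists_norm_fourierProd_div_sub_le (p : ℕ) :
    ∃ C > (0 : ℝ), ∃ ε > (0 : ℝ), ∀ n : ℕ, 0 < n → ∀ x : Fin n → ℝ,
      ∑ k, x k = 0 → ∑ k, x k ^ 2 = 1 →
      ∑ k, (x k ^ 2 + 1 / n) ^ ((3 : ℝ) / 2) ≤ ε →
      fourierProd x 0 ≠ 0 ∧ ∀ z : ℂ, |z.im| ≤ 1 →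
      Integrable (fun τ : ℝ => ∏ k, expCharFun (τ * ((√n)⁻¹ : ℝ) - z * x k)) ∧
      ‖fourierProd x z / fourierProd x 0 - Complex.exp (-z ^ 2 / 2)‖ ≤
        C * (∑ k, (x k ^ 2 + 1 / n) ^ ((3 : ℝ) / 2)) * ((1 + z.re ^ 2) ^ p)⁻¹ := by
  obtain ⟨C, hC, ε, hε, h⟩ := exists_norm_fourierProd_sub_le p
  set G : ℝ := p.factorial * 2 ^ p * exp 1 with hG
  refine ⟨C * (1 + G), by positivity, min ε C⁻¹, by positivity, fun n hn x hx0 hx1 hm => ?_⟩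
  have hb := h n hn x hx0 hx1 (hm.trans (min_le_left _ _))
  have hm2 := hm.trans (min_le_right _ _)
  have hm0 : 0 ≤ ∑ k, (x k ^ 2 + 1 / (n : ℝ)) ^ ((3 : ℝ) / 2) :=
    sum_nonneg fun i _ => by positivity
  set m := ∑ k, (x k ^ 2 + 1 / (n : ℝ)) ^ ((3 : ℝ) / 2)
  have hF0 : ‖fourierProd x 0 - √(2 * π)‖ ≤ C * m := by simpa using (hb 0 (by simp)).2
  have hCm : C * m ≤ 1 := by
    calc C * m ≤ C * C⁻¹ := by gcongr
      _ = 1 := mul_inv_cancel₀ hC.ne'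
  have hF1 : 1 ≤ ‖fourierProd x 0‖ := by
    have h1 : 2 ≤ √(2 * π) := le_sqrt_of_sq_le (by linarith [pi_gt_three])
    have h2 : ‖(√(2 * π) : ℂ)‖ = √(2 * π) :=
      Complex.norm_of_nonneg (sqrt_nonneg _)
    have h3 := norm_sub_norm_le (√(2 * π) : ℂ) (fourierProd x 0)
    rw [norm_sub_rev] at h3
    linarith
  have hne : fourierProd x 0 ≠ 0 := by rw [← norm_pos_iff]; linarith
  refine ⟨hne, fun z hz => ⟨(hb z hz).1, ?_⟩⟩
  have e : fourierProd x z / fourierProd x 0 - Complex.exp (-z ^ 2 / 2) =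
      ((fourierProd x z - √(2 * π) * Complex.exp (-z ^ 2 / 2)) -
        (fourierProd x 0 - √(2 * π)) * Complex.exp (-z ^ 2 / 2)) / fourierProd x 0 := by
    field_simp
    ring
  have hg := norm_exp_neg_sq_div_two_le_inv_pow p hz
  rw [e, norm_div]
  refine (div_le_self (norm_nonneg _) hF1).trans ((norm_sub_le _ _).trans ?_)
  rw [norm_mul]
  calc _ ≤ C * m * ((1 + z.re ^ 2) ^ p)⁻¹ + C * m * (G * ((1 + z.re ^ 2) ^ p)⁻¹) := by
        gcongr
        exact (hb z hz).2
    _ = _ := by ring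

theorem pow_mul_norm_iteratedDeriv_le {H : ℂ → ℂ} (hH : Differentiable ℂ H) (p q : ℕ) {B : ℝ}
    (hB : ∀ z : ℂ, |z.im| ≤ 1 → ‖H z‖ ≤ B * ((1 + z.re ^ 2) ^ p)⁻¹) (ξ : ℝ) :
    |ξ| ^ p * ‖iteratedDeriv q H ξ‖ ≤ q.factorial * 3 ^ p * B := by
  have hB0 : 0 ≤ B := by simpa using (norm_nonneg _).trans (hB 0 (by simp))
  have h := Complex.norm_iteratedDeriv_le_of_forall_mem_sphere_norm_le (c := (ξ : ℂ)) (R := 1)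
    (C := B * (3 ^ p * ((1 + ξ ^ 2) ^ p)⁻¹)) q one_pos hH.diffContOnCl (fun z hz => by
      have hz1 : ‖z - ξ‖ = 1 := by simpa [dist_eq_norm] using hz
      have hre := Complex.abs_re_le_norm (z - ξ)
      have him := Complex.abs_im_le_norm (z - ξ)
      rw [hz1] at hre him
      simp only [Complex.sub_re, Complex.sub_im, Complex.ofReal_re, Complex.ofReal_im, sub_zero]
        at hre him
      refine (hB z him).trans ?_
      gcongr
      rw [inv_le_iff_one_le_mul₀ (by positivity), mul_right_comm, ← div_eq_mul_inv,
        le_div_iff₀ (by positivity), one_mul, ← mul_pow]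
      gcongr
      obtain ⟨h1, h2⟩ := abs_le.1 hre
      nlinarith [sq_nonneg (2 * z.re - ξ)])
  have h3 : |ξ| ^ p ≤ (1 + ξ ^ 2) ^ p := by
    gcongr
    nlinarith [sq_abs ξ, sq_nonneg (|ξ| - 1), abs_nonneg ξ]
  calc |ξ| ^ p * ‖iteratedDeriv q H ξ‖
      ≤ (1 + ξ ^ 2) ^ p * (q.factorial * (B * (3 ^ p * ((1 + ξ ^ 2) ^ p)⁻¹)) / 1 ^ q) := by gcongr
    _ = _ := by field_simp; simp

theorem iteratedDeriv_re_comp_ofReal {H : ℂ → ℂ} (hH : Differentiable ℂ H) (q : ℕ) :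
    iteratedDeriv q (fun u : ℝ => (H u).re) = fun u : ℝ => (iteratedDeriv q H u).re := by
  induction q with
  | zero => simp
  | succ q ih =>
    rw [iteratedDeriv_succ, ih, iteratedDeriv_succ]
    funext u
    have hd : Differentiable ℂ (iteratedDeriv q H) :=
      (hH.contDiff (n := ⊤)).differentiable_iteratedDeriv q (by exact_mod_cast WithTop.coe_lt_top _)
    exact ((hd u).hasDerivAt.real_of_complex).deriv

/-- The hyperplane of vectors whose coordinates sum to zero. -/
noncomputable def sumZero (n : ℕ) : Submodule ℝ (EuclideanSpace ℝ (Fin n)) :=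
  LinearMap.ker (∑ k, EuclideanSpace.projₗ (𝕜 := ℝ) k)

theorem mem_sumZero {n : ℕ} {w : EuclideanSpace ℝ (Fin n)} : w ∈ sumZero n ↔ ∑ k, w k = 0 := by
  simp [sumZero]

theorem finrank_sumZero {n : ℕ} (hn : 0 < n) : Module.finrank ℝ (sumZero n) = n - 1 := by
  have hne : (∑ k, EuclideanSpace.projₗ (𝕜 := ℝ) k : Module.Dual ℝ (EuclideanSpace ℝ (Fin n))) ≠ 0 := by
    intro h
    have := congrArg (fun f => f (EuclideanSpace.single (⟨0, hn⟩ : Fin n) (1 : ℝ))) h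
    simp at this
  have := Module.Dual.finrank_ker_add_one_of_ne_zero hne
  rw [finrank_euclideanSpace_fin] at this
  rw [sumZero]
  omega

/-- The linear change of coordinates `(r, w) ↦ w + (r / n) (1, …, 1)`. -/
noncomputable def sliceEquiv {n : ℕ} (hn : 0 < n) : (ℝ × sumZero n) ≃L[ℝ] (Fin n → ℝ) :=
  LinearEquiv.toContinuousLinearEquiv
    { toFun := fun v k => (v.2 : EuclideanSpace ℝ (Fin n)) k + v.1 * (1 / n)
      map_add' := fun v w => by ext k; simp; ring
      map_smul' := fun c v => by ext k; simp; ring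
      invFun := fun y => (∑ k, y k, ⟨WithLp.toLp 2 fun k => y k - (∑ j, y j) * (1 / n), by
        have : (n : ℝ) ≠ 0 := by exact_mod_cast hn.ne'
        rw [mem_sumZero]
        simp
        field_simp
        simp⟩)
      left_inv := fun v => by
        have : (n : ℝ) ≠ 0 := by exact_mod_cast hn.ne'
        have h := mem_sumZero.1 v.2.2
        have h2 : ∑ k, ((v.2 : EuclideanSpace ℝ (Fin n)) k + v.1 * (1 / n)) = v.1 := by
          rw [sum_add_distrib, h]
          simp
          field_simp
        ext k
        · exact h2
        · simp only [h2]; simp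
      right_inv := fun y => by ext k; simp }

theorem sliceEquiv_apply {n : ℕ} (hn : 0 < n) (r : ℝ) (w : sumZero n) (k : Fin n) :
    sliceEquiv hn (r, w) k = (w : EuclideanSpace ℝ (Fin n)) k + r * (1 / n) := rfl

theorem sum_sliceEquiv {n : ℕ} (hn : 0 < n) (r : ℝ) (w : sumZero n) :
    ∑ k, sliceEquiv hn (r, w) k = r := by
  have : (n : ℝ) ≠ 0 := by exact_mod_cast hn.ne'
  simp_rw [sliceEquiv_apply, sum_add_distrib, mem_sumZero.1 w.2]
  simp
  field_simp

theorem exists_integral_slice {n : ℕ} (hn : 0 < n) : ∃ c : ℝ, c ≠ 0 ∧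
    ∀ f : (Fin n → ℝ) → ℂ, Integrable f →
      Integrable (fun r : ℝ => ∫ w, f (sliceEquiv hn (r, w)) ∂μH[Module.finrank ℝ (sumZero n)]) ∧
      ∫ r : ℝ, ∫ w, f (sliceEquiv hn (r, w)) ∂μH[Module.finrank ℝ (sumZero n)] = c * ∫ y, f y := by
  set μ : Measure (ℝ × sumZero n) :=
    (volume : Measure ℝ).prod (μH[Module.finrank ℝ (sumZero n)] : Measure (sumZero n)) with hμ
  have hH : Measure.IsAddHaarMeasure (μ.map (sliceEquiv hn)) := inferInstance
  set c := Measure.addHaarScalarFactor (μ.map (sliceEquiv hn)) volume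
  have hc : 0 < c := Measure.addHaarScalarFactor_pos_of_isAddHaarMeasure _ _
  have hm : μ.map (sliceEquiv hn) = c • volume := Measure.isAddLeftInvariant_eq_smul _ _
  have hemb : MeasurableEmbedding (sliceEquiv hn) :=
    (sliceEquiv hn).toHomeomorph.measurableEmbedding
  refine ⟨c, by exact_mod_cast hc.ne', fun f hf => ?_⟩
  have hf' : Integrable f (μ.map (sliceEquiv hn)) := by
    rw [hm]; exact hf.smul_measure_nnreal
  have hf2 : Integrable (fun v => f (sliceEquiv hn v)) μ := hemb.integrable_map_iff.1 hf'
  refine ⟨hf2.integral_prod_left, ?_⟩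
  rw [← integral_prod _ hf2, ← hemb.integral_map, hm, integral_smul_nnreal_measure]
  simp [NNReal.smul_def]

/-- The standard simplex. -/
def simplexSet (n : ℕ) : Set (EuclideanSpace ℝ (Fin n)) := {s | (∀ k, 0 ≤ s k) ∧ ∑ k, s k = 1}

/-- The standard simplex translated into the hyperplane `sumZero n`. -/
def centredSimplex (n : ℕ) : Set (sumZero n) :=
  {w | ∀ k, 0 ≤ (w : EuclideanSpace ℝ (Fin n)) k + 1 / n}

theorem isClosed_simplexSet (n : ℕ) : IsClosed (simplexSet n) := by
  have : simplexSet n = (⋂ k, {s | 0 ≤ s k}) ∩ {s | ∑ k, s k = 1} := by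
    ext s; simp [simplexSet]
  rw [this]
  refine IsClosed.inter (isClosed_iInter fun k => isClosed_le continuous_const (by fun_prop))
    (isClosed_eq (by fun_prop) continuous_const)

theorem norm_le_of_mem_simplexSet {n : ℕ} {s : EuclideanSpace ℝ (Fin n)} (hs : s ∈ simplexSet n) :
    ‖s‖ ≤ 1 := by
  have h1 : ∀ k, s k ≤ 1 := fun k => by
    rw [← hs.2]; exact single_le_sum (fun i _ => hs.1 i) (mem_univ k)
  rw [EuclideanSpace.norm_eq, sqrt_le_one, ← hs.2]
  refine sum_le_sum fun k _ => ?_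
  rw [norm_eq_abs, sq_abs]
  nlinarith [hs.1 k, h1 k]

theorem isCompact_simplexSet (n : ℕ) : IsCompact (simplexSet n) :=
  Metric.isCompact_of_isClosed_isBounded (isClosed_simplexSet n)
    (Metric.isBounded_closedBall.subset fun _ hs => mem_closedBall_zero_iff.2
      (norm_le_of_mem_simplexSet hs))

/-- The translation of the hyperplane `sumZero n` onto the affine hull of the simplex. -/
noncomputable def simplexShift (n : ℕ) (w : sumZero n) : EuclideanSpace ℝ (Fin n) :=
  (w : EuclideanSpace ℝ (Fin n)) + WithLp.toLp 2 fun _ => (1 / n : ℝ)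

theorem isometry_simplexShift (n : ℕ) : Isometry (simplexShift n) := by
  refine Isometry.of_dist_eq fun a b => ?_
  simp [simplexShift, Subtype.dist_eq]

theorem simplexShift_preimage {n : ℕ} (hn : 0 < n) :
    simplexShift n ⁻¹' simplexSet n = centredSimplex n := by
  have : (n : ℝ) ≠ 0 := by exact_mod_cast hn.ne'
  ext w
  have h := mem_sumZero.1 w.2
  simp [simplexShift, simplexSet, centredSimplex, sum_add_distrib, h, this]

theorem simplexSet_subset_range {n : ℕ} (hn : 0 < n) :
    simplexSet n ⊆ Set.range (simplexShift n) := by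
  have : (n : ℝ) ≠ 0 := by exact_mod_cast hn.ne'
  intro s hs
  refine ⟨⟨s - WithLp.toLp 2 fun _ => (1 / n : ℝ), ?_⟩, by simp [simplexShift]⟩
  rw [mem_sumZero]
  simp [hs.2, this]

theorem measurableEmbedding_simplexShift (n : ℕ) : MeasurableEmbedding (simplexShift n) :=
  (isometry_simplexShift n).isClosedEmbedding.measurableEmbedding

theorem restrict_simplexSet {n : ℕ} (hn : 0 < n) :
    (μH[(n : ℝ) - 1] : Measure (EuclideanSpace ℝ (Fin n))).restrict (simplexSet n) =
      ((μH[Module.finrank ℝ (sumZero n)] : Measure (sumZero n)).restrict (centredSimplex n)).map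
        (simplexShift n) := by
  have hd : (Module.finrank ℝ (sumZero n) : ℝ) = n - 1 := by
    rw [finrank_sumZero hn, Nat.cast_sub hn, Nat.cast_one]
  rw [← simplexShift_preimage hn, ← (measurableEmbedding_simplexShift n).restrict_map,
    (isometry_simplexShift n).map_hausdorffMeasure (Or.inl (Nat.cast_nonneg _)),
    Measure.restrict_restrict (isClosed_simplexSet n).measurableSet,
    Set.inter_eq_left.2 (simplexSet_subset_range hn), hd]

theorem measure_simplexSet_lt_top {n : ℕ} (hn : 0 < n) :
    (μH[(n : ℝ) - 1] : Measure (EuclideanSpace ℝ (Fin n))) (simplexSet n) < ⊤ := by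
  have hcomp : IsCompact (centredSimplex n) := by
    rw [← simplexShift_preimage hn]
    exact (isometry_simplexShift n).isClosedEmbedding.isCompact_preimage (isCompact_simplexSet n)
  rw [← Measure.restrict_apply_self, restrict_simplexSet hn,
    (measurableEmbedding_simplexShift n).map_apply]
  exact (measure_mono (Set.subset_univ _)).trans_lt
    (by rw [Measure.restrict_apply_univ]; exact hcomp.measure_lt_top)

theorem measurableSet_centredSimplex {n : ℕ} (hn : 0 < n) : MeasurableSet (centredSimplex n) := by
  rw [← simplexShift_preimage hn]
  exact ((isClosed_simplexSet n).preimage (isometry_simplexShift n).continuous).measurableSet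

/-- The unnormalised Fourier transform of the uniform measure on the simplex in direction `x`. -/
noncomputable def simplexTransform {n : ℕ} (x : Fin n → ℝ) (z : ℂ) : ℂ :=
  ∫ s in simplexSet n, Complex.exp (Complex.I * z * (∑ k, x k * s k : ℝ)) ∂μH[(n : ℝ) - 1]

theorem simplexTransform_eq_integral_centredSimplex {n : ℕ} (hn : 0 < n) (x : Fin n → ℝ) (z : ℂ) :
    simplexTransform x z = ∫ w in centredSimplex n, Complex.exp (Complex.I * z *
      (∑ k, x k * ((w : EuclideanSpace ℝ (Fin n)) k + 1 / n) : ℝ))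
        ∂μH[Module.finrank ℝ (sumZero n)] := by
  rw [simplexTransform, restrict_simplexSet hn, (measurableEmbedding_simplexShift n).integral_map]
  rfl

theorem differentiable_simplexTransform {n : ℕ} (hn : 0 < n) (x : Fin n → ℝ) :
    Differentiable ℂ (simplexTransform x) := by
  set ν : Measure (EuclideanSpace ℝ (Fin n)) := (μH[(n : ℝ) - 1]).restrict (simplexSet n) with hν
  have : IsFiniteMeasure ν := ⟨by
    rw [hν, Measure.restrict_apply_univ]; exact measure_simplexSet_lt_top hn⟩
  set X : EuclideanSpace ℝ (Fin n) → ℝ := fun s => ∑ k, x k * s k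
  have hX : Continuous X := by fun_prop
  have hset : ProbabilityTheory.integrableExpSet X ν = Set.univ := by
    refine Set.eq_univ_of_forall fun t => ?_
    have hc : Continuous fun s => exp (t * X s) := by fun_prop
    obtain ⟨B, hB⟩ := (isCompact_simplexSet n).exists_bound_of_continuousOn hc.continuousOn
    exact Integrable.of_bound hc.aestronglyMeasurable B
      (ae_restrict_of_forall_mem (isClosed_simplexSet n).measurableSet hB)
  have h : simplexTransform x = fun z => ProbabilityTheory.complexMGF X ν (Complex.I * z) := rfl
  have hd : Differentiable ℂ (ProbabilityTheory.complexMGF X ν) := by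
    rw [← differentiableOn_univ]
    simpa [hset] using ProbabilityTheory.differentiableOn_complexMGF (X := X) (μ := ν)
  rw [h]
  exact hd.comp (differentiable_id.const_mul _)

/-- The product of the (modulated) densities of independent exponential variables. -/
noncomputable def expDensity {n : ℕ} (x : Fin n → ℝ) (z : ℂ) (t : ℝ) (y : Fin n → ℝ) : ℂ :=
  ∏ k, (Set.Ici (0 : ℝ)).indicator
    (fun v : ℝ => Complex.exp (-(1 + Complex.I * (t - z * x k)) * v)) (y k)

theorem expDensity_of_nonneg {n : ℕ} (x : Fin n → ℝ) (z : ℂ) (t : ℝ) {y : Fin n → ℝ}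
    (hy : ∀ k, 0 ≤ y k) : expDensity x z t y =
      Complex.exp (-(1 + Complex.I * t) * (∑ k, y k : ℝ)) *
        Complex.exp (Complex.I * z * (∑ k, x k * y k : ℝ)) := by
  rw [expDensity, ← Complex.exp_add]
  simp_rw [Set.indicator_of_mem (Set.mem_Ici.2 (hy _))]
  rw [← Complex.exp_sum]
  congr 1
  push_cast
  rw [mul_sum, mul_sum, ← sum_add_distrib]
  exact sum_congr rfl fun k _ => by ring

theorem expDensity_of_neg {n : ℕ} (x : Fin n → ℝ) (z : ℂ) (t : ℝ) {y : Fin n → ℝ} {k : Fin n}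
    (hy : y k < 0) : expDensity x z t y = 0 :=
  prod_eq_zero (mem_univ k) (Set.indicator_of_notMem (by simpa using hy) _)

theorem re_neg_one_add_I_mul_lt {a : ℝ} {z : ℂ} (hz : |z.im * a| < 1) (t : ℝ) :
    (-(1 + Complex.I * (t - z * a))).re < 0 := by
  have := (abs_lt.1 hz).1
  simp
  linarith

theorem integrable_expDensity {n : ℕ} {x : Fin n → ℝ} {z : ℂ} (hz : ∀ k, |z.im * x k| < 1) (t : ℝ) :
    Integrable (expDensity x z t) :=
  Integrable.fintype_prod fun k => by
    rw [integrable_indicator_iff measurableSet_Ici, integrableOn_Ici_iff_integrableOn_Ioi]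
    exact integrableOn_exp_mul_complex_Ioi (re_neg_one_add_I_mul_lt (hz k) t) 0

theorem integral_expDensity {n : ℕ} {x : Fin n → ℝ} {z : ℂ} (hz : ∀ k, |z.im * x k| < 1) (t : ℝ) :
    ∫ y, expDensity x z t y = ∏ k, (1 + Complex.I * (t - z * x k))⁻¹ := by
  simp_rw [expDensity]
  rw [integral_fintype_prod_volume_eq_prod (fun k => (Set.Ici (0 : ℝ)).indicator
    (fun v : ℝ => Complex.exp (-(1 + Complex.I * (t - z * x k)) * v)))]
  refine prod_congr rfl fun k _ => ?_
  rw [integral_indicator measurableSet_Ici, integral_Ici_eq_integral_Ioi,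
    integral_exp_mul_complex_Ioi (re_neg_one_add_I_mul_lt (hz k) t)]
  simp [-neg_add_rev, neg_div_neg_eq]

theorem integral_slice_of_neg {n : ℕ} (hn : 0 < n) (x : Fin n → ℝ) (z : ℂ) (t : ℝ) {r : ℝ}
    (hr : r < 0) :
    ∫ w, expDensity x z t (sliceEquiv hn (r, w)) ∂μH[Module.finrank ℝ (sumZero n)] = 0 := by
  refine integral_eq_zero_of_ae (Filter.Eventually.of_forall fun w => ?_)
  obtain ⟨k, -, hk⟩ := exists_lt_of_sum_lt (s := univ) (f := sliceEquiv hn (r, w)) (g := fun _ => 0)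
    (by rw [sum_sliceEquiv]; simpa using hr)
  exact expDensity_of_neg x z t hk

theorem integral_slice_of_pos {n : ℕ} (hn : 0 < n) (x : Fin n → ℝ) (z : ℂ) (t : ℝ) {r : ℝ}
    (hr : 0 < r) :
    ∫ w, expDensity x z t (sliceEquiv hn (r, w)) ∂μH[Module.finrank ℝ (sumZero n)] =
      r ^ (n - 1) * Complex.exp (-(1 + Complex.I * t) * r) * simplexTransform x (r * z) := by
  have h := Measure.integral_comp_smul (μH[Module.finrank ℝ (sumZero n)] : Measure (sumZero n))
    (fun w => expDensity x z t (sliceEquiv hn (r, w))) r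
  have hs : ∀ w : sumZero n, expDensity x z t (sliceEquiv hn (r, r • w)) =
      (centredSimplex n).indicator (fun w => Complex.exp (-(1 + Complex.I * t) * r) *
        Complex.exp (Complex.I * (r * z) *
          (∑ k, x k * ((w : EuclideanSpace ℝ (Fin n)) k + 1 / n) : ℝ))) w := fun w => by
    have hk : ∀ k, sliceEquiv hn (r, r • w) k =
        r * ((w : EuclideanSpace ℝ (Fin n)) k + 1 / n) := fun k => by
      rw [sliceEquiv_apply]; simp; ring
    by_cases hw : w ∈ centredSimplex n
    · rw [Set.indicator_of_mem hw, expDensity_of_nonneg, sum_sliceEquiv]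
      · congr 2
        simp_rw [hk]
        push_cast
        simp_rw [mul_sum]
        exact sum_congr rfl fun k _ => by ring
      · exact fun k => by rw [hk]; exact mul_nonneg hr.le (hw k)
    · rw [Set.indicator_of_notMem hw]
      simp only [centredSimplex, Set.mem_ofPred_eq, not_forall, not_le] at hw
      obtain ⟨k, hwk⟩ := hw
      exact expDensity_of_neg x z t (k := k) (by rw [hk]; exact mul_neg_of_pos_of_neg hr hwk)
  simp_rw [hs] at h
  rw [integral_indicator (measurableSet_centredSimplex hn), integral_const_mul,
    ← simplexTransform_eq_integral_centredSimplex hn, finrank_sumZero hn,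
    abs_of_pos (by positivity)] at h
  rw [finrank_sumZero hn, mul_assoc, h, Complex.real_smul]
  push_cast
  rw [mul_inv_cancel_left₀]
  exact pow_ne_zero _ (by exact_mod_cast hr.ne')

theorem prod_inv_mul_exp {n : ℕ} {x : Fin n → ℝ} (hx0 : ∑ k, x k = 0) (z : ℂ) (v : ℝ) :
    Complex.exp (Complex.I * (n * v)) * ∏ k, (1 + Complex.I * (v - z * x k))⁻¹ =
      ∏ k, expCharFun (v - z * x k) := by
  have h : Complex.exp (Complex.I * (n * v)) = ∏ k, Complex.exp (Complex.I * (v - z * x k)) := by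
    rw [← Complex.exp_sum, ← mul_sum, sum_sub_distrib, ← mul_sum, ← Complex.ofReal_sum univ x, hx0]
    simp
  rw [h, ← prod_mul_distrib]
  rfl

/-- The function whose Fourier transform is the product of the exponential transforms. -/
noncomputable def radialTransform {n : ℕ} (x : Fin n → ℝ) (z : ℂ) : ℝ → ℂ :=
  (Set.Ioi 0).indicator fun r : ℝ => r ^ (n - 1) * exp (-r) * simplexTransform x (r * z)

theorem integral_slice_ae_eq {n : ℕ} (hn : 0 < n) (x : Fin n → ℝ) (z : ℂ) (t : ℝ) :
    (fun r : ℝ => ∫ w, expDensity x z t (sliceEquiv hn (r, w)) ∂μH[Module.finrank ℝ (sumZero n)])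
      =ᵐ[volume] fun r => Complex.exp (-(Complex.I * t * r)) * radialTransform x z r := by
  filter_upwards [Measure.ae_ne volume (0 : ℝ)] with r hr
  rcases lt_or_gt_of_ne hr with h | h
  · rw [integral_slice_of_neg hn x z t h, radialTransform,
      Set.indicator_of_notMem (by simpa using h.le), mul_zero]
  · rw [integral_slice_of_pos hn x z t h, radialTransform, Set.indicator_of_mem (Set.mem_Ioi.2 h)]
    have : Complex.exp (-(1 + Complex.I * t) * r) =
        Complex.exp (-(Complex.I * t * r)) * (exp (-r) : ℝ) := by
      push_cast
      rw [← Complex.exp_add]; ring_nf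
    rw [this]
    ring

open FourierTransform in
theorem exists_fourierProd_eq {n : ℕ} (hn : 0 < n) {x : Fin n → ℝ} (hx0 : ∑ k, x k = 0) :
    ∃ K : ℂ, ∀ z : ℂ, (∀ k, |z.im * x k| < 1) →
      Integrable (fun τ : ℝ => ∏ k, expCharFun (τ * ((√n)⁻¹ : ℝ) - z * x k)) →
      fourierProd x z = K * simplexTransform x (n * z) := by
  obtain ⟨c, hc, hslice⟩ := exists_integral_slice hn
  have hn' : (0 : ℝ) < n := by exact_mod_cast hn
  have hsn : 0 < √(n : ℝ) := sqrt_pos.2 hn'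
  refine ⟨2 * π * √n / c * (n ^ (n - 1) * exp (-n)), fun z hz hi => ?_⟩
  set g := radialTransform x z with hg
  have hgi : Integrable g := by
    refine ((hslice _ (integrable_expDensity hz 0)).1.congr (integral_slice_ae_eq hn x z 0)).congr
      (Filter.Eventually.of_forall fun r => ?_)
    simp [hg]
  have hgF : ∀ t : ℝ, 𝓕 g t = c * ∏ k, (1 + Complex.I * ((2 * π * t : ℝ) - z * x k))⁻¹ := fun t => by
    rw [← integral_expDensity hz, ← (hslice _ (integrable_expDensity hz _)).2,
      integral_congr_ae (integral_slice_ae_eq hn x z (2 * π * t)), Real.fourier_real_eq_integral_exp_smul]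
    refine integral_congr_ae (Filter.Eventually.of_forall fun r => ?_)
    simp only [smul_eq_mul]
    congr 2
    push_cast
    ring
  have hexp : ∀ t : ℝ, Complex.exp (Complex.I * (n * (2 * π * t : ℝ))) * 𝓕 g t =
      c * ∏ k, expCharFun (((2 * π * √n * t : ℝ) : ℂ) * ((√n)⁻¹ : ℝ) - z * x k) := fun t => by
    have e : ((2 * π * √n * t : ℝ) : ℂ) * ((√n)⁻¹ : ℝ) = (2 * π * t : ℝ) := by
      rw [← Complex.ofReal_mul]; congr 1; field_simp
    rw [e, ← prod_inv_mul_exp hx0, hgF]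
    ring
  have hpos : 0 < 2 * π * √(n : ℝ) := by positivity
  have hFi' : Integrable fun t : ℝ => Complex.exp (Complex.I * (n * (2 * π * t : ℝ))) * 𝓕 g t := by
    simp_rw [hexp]
    exact (hi.comp_mul_left' hpos.ne').const_mul _
  have hFi : Integrable (𝓕 g) := by
    have : 𝓕 g = fun t : ℝ => Complex.exp (-(Complex.I * (n * (2 * π * t : ℝ)))) *
        (Complex.exp (Complex.I * (n * (2 * π * t : ℝ))) * 𝓕 g t) := by
      funext t
      rw [← mul_assoc, ← Complex.exp_add]
      simp
    rw [this]
    refine hFi'.bdd_mul (c := 1) (by fun_prop) (Filter.Eventually.of_forall fun t => ?_)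
    rw [Complex.norm_exp]
    simp
  have hcont : ContinuousAt g n := by
    have h1 : Continuous fun r : ℝ =>
        (r ^ (n - 1) * exp (-r) : ℂ) * simplexTransform x (r * z) := by
      have := (differentiable_simplexTransform hn x).continuous
      fun_prop
    refine h1.continuousAt.congr ?_
    filter_upwards [Ioi_mem_nhds hn'] with r hr
    simp only [hg, radialTransform]
    rw [Set.indicator_of_mem hr]
  have hinv := hgi.fourierInv_fourier_eq hFi hcont
  rw [Real.fourierInv_eq_fourier_neg, Real.fourier_real_eq_integral_exp_smul] at hinv
  have hinv2 : ∫ t : ℝ, Complex.exp (Complex.I * (n * (2 * π * t : ℝ))) * 𝓕 g t = g n := by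
    rw [← hinv]
    refine integral_congr_ae (Filter.Eventually.of_forall fun r => ?_)
    simp only [smul_eq_mul]
    congr 2
    push_cast
    ring
  simp_rw [hexp] at hinv2
  rw [integral_const_mul, Measure.integral_comp_mul_left
    (fun τ : ℝ => ∏ k, expCharFun ((τ : ℂ) * ((√n)⁻¹ : ℝ) - z * x k)), hg, radialTransform,
    Set.indicator_of_mem (Set.mem_Ioi.2 hn'), abs_of_pos (by positivity), Complex.real_smul,
    ← fourierProd] at hinv2
  have hc' : (c : ℂ) ≠ 0 := by exact_mod_cast hc
  have hA : ((2 * π * √n : ℝ) : ℂ) ≠ 0 := by exact_mod_cast hpos.ne'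
  have h3 : fourierProd x z = ((2 * π * √n : ℝ) : ℂ) / c *
      (c * (((2 * π * √n : ℝ)⁻¹ : ℝ) * fourierProd x z)) := by
    rw [Complex.ofReal_inv]
    field_simp
  rw [h3, hinv2]
  push_cast
  ring

theorem exists_norm_simplexTransform_div_sub_le (p : ℕ) :
    ∃ C > (0 : ℝ), ∃ ε > (0 : ℝ), ∀ n : ℕ, 0 < n → ∀ x : Fin n → ℝ,
      ∑ k, x k = 0 → ∑ k, x k ^ 2 = 1 →
      ∑ k, (x k ^ 2 + 1 / n) ^ ((3 : ℝ) / 2) ≤ ε →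
      simplexTransform x 0 ≠ 0 ∧ ∀ z : ℂ, |z.im| ≤ 1 →
      ‖simplexTransform x (n * z) / simplexTransform x 0 - Complex.exp (-z ^ 2 / 2)‖ ≤
        C * (∑ k, (x k ^ 2 + 1 / n) ^ ((3 : ℝ) / 2)) * ((1 + z.re ^ 2) ^ p)⁻¹ := by
  obtain ⟨C, hC, ε, hε, h⟩ := exists_norm_fourierProd_div_sub_le p
  refine ⟨C, hC, min ε (1 / 2), by positivity, fun n hn x hx0 hx1 hm => ?_⟩
  obtain ⟨hF0, hF⟩ := h n hn x hx0 hx1 (hm.trans (min_le_left _ _))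
  have hxk : ∀ k, |x k| < 1 := fun k => by
    have h1 : (x k ^ 2 + 1 / n) ^ ((3 : ℝ) / 2) ≤ 1 / 2 :=
      (single_le_sum (f := fun k => (x k ^ 2 + 1 / (n : ℝ)) ^ ((3 : ℝ) / 2))
        (fun i _ => by positivity) (mem_univ k)).trans (hm.trans (min_le_right _ _))
    by_contra! h2
    have h3 : 1 ≤ x k ^ 2 + 1 / (n : ℝ) := by
      have : (0 : ℝ) ≤ 1 / n := by positivity
      nlinarith [sq_abs (x k)]
    linarith [one_le_rpow h3 (by norm_num : (0 : ℝ) ≤ 3 / 2)]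
  obtain ⟨K, hK⟩ := exists_fourierProd_eq hn hx0
  have hK' : ∀ z : ℂ, |z.im| ≤ 1 → fourierProd x z = K * simplexTransform x (n * z) :=
    fun z hz => hK z (fun k => by
      rw [abs_mul]
      exact (mul_le_of_le_one_left (abs_nonneg _) hz).trans_lt (hxk k)) (hF z hz).1
  have h0 := hK' 0 (by simp)
  rw [mul_zero] at h0
  rw [h0] at hF0
  refine ⟨right_ne_zero_of_mul hF0, fun z hz => ?_⟩
  have := (hF z hz).2
  rwa [hK' z hz, h0, mul_div_mul_left _ _ (left_ne_zero_of_mul hF0)] at this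

theorem simplexTransform_zero {n : ℕ} (x : Fin n → ℝ) :
    simplexTransform x 0 = ((μH[(n : ℝ) - 1] (simplexSet n)).toReal : ℂ) := by
  simp [simplexTransform, Measure.real]

theorem integrable_simplexTransform {n : ℕ} (hn : 0 < n) (x : Fin n → ℝ) (u : ℝ) :
    IntegrableOn (fun s : EuclideanSpace ℝ (Fin n) =>
      Complex.exp (Complex.I * (n * u) * (∑ k, x k * s k : ℝ))) (simplexSet n) μH[(n : ℝ) - 1] := by
  refine IntegrableOn.of_bound (measure_simplexSet_lt_top hn)
    (Continuous.aestronglyMeasurable (by fun_prop)) 1 (Filter.Eventually.of_forall fun s => ?_)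
  rw [Complex.norm_exp]
  simp

theorem integral_uniform_simplex_eq {n : ℕ}
    (f : EuclideanSpace ℝ (Fin n) → ℝ) :
    ∫ s, f s ∂((μH[(n : ℝ) - 1] (simplexSet n))⁻¹ • (μH[(n : ℝ) - 1]).restrict (simplexSet n)) =
      (∫ s in simplexSet n, f s ∂μH[(n : ℝ) - 1]) /
        (μH[(n : ℝ) - 1] (simplexSet n)).toReal := by
  rw [integral_smul_measure, ENNReal.toReal_inv, smul_eq_mul, mul_comm, div_eq_mul_inv]

theorem integral_cos_uniform_simplex {n : ℕ} (hn : 0 < n) (x : Fin n → ℝ) (u : ℝ) :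
    ∫ s, cos (n * u * ∑ k, x k * s k)
        ∂((μH[(n : ℝ) - 1] (simplexSet n))⁻¹ • (μH[(n : ℝ) - 1]).restrict (simplexSet n)) =
      (simplexTransform x (n * u) / simplexTransform x 0).re := by
  rw [integral_uniform_simplex_eq, simplexTransform_zero, Complex.div_ofReal_re, simplexTransform]
  congr 1
  refine Eq.trans ?_ (integral_re (integrable_simplexTransform hn x u))
  refine integral_congr_ae (Filter.Eventually.of_forall fun s => ?_)
  have : Complex.I * (n * u) * (∑ k, x k * s k : ℝ) = (n * u * ∑ k, x k * s k : ℝ) * Complex.I := by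
    push_cast; ring
  simp only [this, RCLike.re_eq_complex_re, Complex.exp_ofReal_mul_I_re]

theorem integral_sin_uniform_simplex {n : ℕ} (hn : 0 < n) (x : Fin n → ℝ) (u : ℝ) :
    ∫ s, sin (n * u * ∑ k, x k * s k)
        ∂((μH[(n : ℝ) - 1] (simplexSet n))⁻¹ • (μH[(n : ℝ) - 1]).restrict (simplexSet n)) =
      (simplexTransform x (n * u) / simplexTransform x 0).im := by
  rw [integral_uniform_simplex_eq, simplexTransform_zero, Complex.div_ofReal_im, simplexTransform]
  congr 1
  refine Eq.trans ?_ (integral_im (integrable_simplexTransform hn x u))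
  refine integral_congr_ae (Filter.Eventually.of_forall fun s => ?_)
  have : Complex.I * (n * u) * (∑ k, x k * s k : ℝ) = (n * u * ∑ k, x k * s k : ℝ) * Complex.I := by
    push_cast; ring
  simp only [this, RCLike.im_eq_complex_im, Complex.exp_ofReal_mul_I_im]

theorem exp_neg_sq_div_two_ofReal (u : ℝ) :
    Complex.exp (-(u : ℂ) ^ 2 / 2) = (exp (-u ^ 2 / 2) : ℝ) := by
  push_cast
  rfl

/-- The characteristic function of `n⟨x, S⟩`, where `S` is uniform on the standard simplex,
approximates the Gaussian `e^{-ξ²/2}` in every Schwartz seminorm. -/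
theorem simplex_charfun_gaussian_schwartz (p q : ℕ) :
    ∃ C > (0 : ℝ), ∃ ε > (0 : ℝ), ∃ N : ℕ, ∀ n : ℕ, N ≤ n →
      ∀ x : Fin n → ℝ,
        (∑ k, x k) = 0 → (∑ k, (x k) ^ 2) = 1 →
        (∑ k, ((x k) ^ 2 + 1 / n) ^ ((3 : ℝ) / 2)) ≤ ε →
        ∀ ξ : ℝ,
          (let Δ : Set (EuclideanSpace ℝ (Fin n)) :=
            {s | (∀ k, 0 ≤ s k) ∧ (∑ k, s k) = 1};
          let μ : Measure (EuclideanSpace ℝ (Fin n)) :=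
            (μH[(n : ℝ) - 1] Δ)⁻¹ • (μH[(n : ℝ) - 1]).restrict Δ;
          |ξ| ^ p *
              |iteratedDeriv q
                (fun u : ℝ =>
                  (∫ s, Real.cos (n * u * ∑ k, x k * s k) ∂μ) - Real.exp (-u ^ 2 / 2)) ξ|
            ≤ C * ∑ k, ((x k) ^ 2 + 1 / n) ^ ((3 : ℝ) / 2) ∧
          |ξ| ^ p *
              |iteratedDeriv q
                (fun u : ℝ => ∫ s, Real.sin (n * u * ∑ k, x k * s k) ∂μ) ξ|
            ≤ C * ∑ k, ((x k) ^ 2 + 1 / n) ^ ((3 : ℝ) / 2)) := by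
  obtain ⟨C, hC, ε, hε, h⟩ := exists_norm_simplexTransform_div_sub_le p
  refine ⟨q.factorial * 3 ^ p * C, by positivity, ε, hε, 1, fun n hn x hx0 hx1 hm ξ => ?_⟩
  obtain ⟨-, hb⟩ := h n hn x hx0 hx1 hm
  set m := ∑ k, (x k ^ 2 + 1 / (n : ℝ)) ^ ((3 : ℝ) / 2)
  set H : ℂ → ℂ := fun z =>
    simplexTransform x (n * z) / simplexTransform x 0 - Complex.exp (-z ^ 2 / 2) with hH
  have hHd : Differentiable ℂ H := by
    have := differentiable_simplexTransform hn x
    fun_prop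
  have bound : ∀ a : ℂ, ‖a‖ = 1 →
      |ξ| ^ p * |iteratedDeriv q (fun u : ℝ => (a * H u).re) ξ| ≤ q.factorial * 3 ^ p * C * m := by
    intro a ha
    have hd : Differentiable ℂ fun z => a * H z := hHd.const_mul a
    rw [iteratedDeriv_re_comp_ofReal hd]
    calc _ ≤ |ξ| ^ p * ‖iteratedDeriv q (fun z => a * H z) ξ‖ := by
          gcongr
          exact Complex.abs_re_le_norm _
      _ ≤ q.factorial * 3 ^ p * (C * m) :=
          pow_mul_norm_iteratedDeriv_le hd p q (fun z hz => by
            rw [norm_mul, ha, one_mul]; exact hb z hz) ξ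
      _ = _ := by ring
  refine ⟨?_, ?_⟩
  · refine le_trans (le_of_eq ?_) (bound 1 (by simp))
    congr 3
    funext u
    rw [one_mul, hH, Complex.sub_re, exp_neg_sq_div_two_ofReal, Complex.ofReal_re,
      ← integral_cos_uniform_simplex hn x u]
    rfl
  · refine le_trans (le_of_eq ?_) (bound (-Complex.I) (by simp))
    congr 3
    funext u
    have : (-Complex.I * H u).re = (H u).im := by simp
    rw [this, hH, Complex.sub_im, exp_neg_sq_div_two_ofReal, Complex.ofReal_im, sub_zero,
      ← integral_sin_uniform_simplex hn x u]
    rfl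
end

section
/- Let ℓ, p be nonnegative integers. There exist a constant C > 0, a real ε > 0 and a natural number N (depending only on ℓ and p) such that the following holds: for every n ≥ N and every real sequence x_1, …, x_n with ∑ x_k = 0, ∑ x_k² = 1 and m³ := ∑_{k=1}^n (x_k² + 1/n)^{3/2} ≤ ε, and for every M ≥ 1, ∬_{{ξ ∈ ℝ² : |ξ| > M}} |ξ|^ℓ ∏_{k=1}^n (1 + t_k(ξ)²)^{−1/2} dξ ≤ C M^{−p}, where t_k(ξ) = ξ_1 x_k + ξ_2 n^{−1/2}. -/
open Real Finset MeasureTheory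

/-- If the nonnegative numbers `a k` have sum `s` and none exceeds the fraction `1 / L` of it,
then `∏ (1 + a k) ≥ (1 + s / L) ^ L`. -/
theorem one_add_div_pow_le_prod_one_add {ι : Type*} (t : Finset ι) (a : ι → ℝ) {s : ℝ} {L : ℕ}
    (hL : 0 < L) (hs : 0 < s) (ha : ∀ k ∈ t, 0 ≤ a k) (hle : ∀ k ∈ t, a k ≤ s / L)
    (hsum : ∑ k ∈ t, a k = s) : (1 + s / L) ^ L ≤ ∏ k ∈ t, (1 + a k) := by
  have hL' : (0 : ℝ) < L := by exact_mod_cast hL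
  have hb : 0 < s / L := by positivity
  have key : ∏ k ∈ t, (1 + s / L) ^ (a k / (s / L)) = (1 + s / L) ^ L := by
    rw [← Real.rpow_sum_of_pos (by positivity), ← Finset.sum_div, hsum, ← Real.rpow_natCast]
    congr 1
    field_simp
  rw [← key]
  refine Finset.prod_le_prod (fun k _ => by positivity) fun k hk => ?_
  have h := rpow_one_add_le_one_add_mul_self (s := s / L) (by linarith)
    (div_nonneg (ha k hk) hb.le) ((div_le_one hb).2 (hle k hk))
  rwa [div_mul_cancel₀ _ hb.ne'] at h

/-- For an isotropic system of vectors `(x k, n ^ (-1/2))`, all of squared length at most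
`1 / (2 * q)`, the product decays like `|ξ| ^ (-2 * q)`. -/
theorem prod_one_add_sq_rpow_le {n q : ℕ} (hn : 0 < n) (hq : 0 < q) {x : Fin n → ℝ}
    (h0 : ∑ k, x k = 0) (h1 : ∑ k, x k ^ 2 = 1)
    (hx : ∀ k, x k ^ 2 + 1 / n ≤ 1 / (2 * q)) (u v : ℝ) (hr : 0 < u ^ 2 + v ^ 2) :
    ∏ k, (1 + (u * x k + v / Real.sqrt n) ^ 2) ^ (-(1 : ℝ) / 2)
      ≤ (2 * q) ^ q / (u ^ 2 + v ^ 2) ^ q := by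
  have hn' : (0 : ℝ) < n := by exact_mod_cast hn
  have hq' : (0 : ℝ) < q := by exact_mod_cast hq
  have hsq : (1 / Real.sqrt n) ^ 2 = 1 / (n : ℝ) := by
    rw [div_pow, Real.sq_sqrt hn'.le, one_pow]
  have hsum : ∑ k, (u * x k + v / Real.sqrt n) ^ 2 = u ^ 2 + v ^ 2 := by
    have h (k : Fin n) : (u * x k + v / Real.sqrt n) ^ 2
        = u ^ 2 * x k ^ 2 + 2 * u * v / Real.sqrt n * x k + v ^ 2 * (1 / n) := by
      rw [← hsq]; ring
    simp only [h, Finset.sum_add_distrib, ← Finset.mul_sum, h0, h1]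
    simp [hn'.ne']
  have hprod := one_add_div_pow_le_prod_one_add Finset.univ
    (fun k => (u * x k + v / Real.sqrt n) ^ 2) (L := 2 * q) (by positivity) hr
    (fun k _ => sq_nonneg _) (fun k _ => by
      have hcs : (u * x k + v / Real.sqrt n) ^ 2
          ≤ (u ^ 2 + v ^ 2) * (x k ^ 2 + 1 / n) := by
        rw [← hsq]
        have := sq_nonneg (u * (1 / Real.sqrt n) - v * x k)
        rw [div_eq_mul_one_div v]
        linarith
      refine hcs.trans ((mul_le_mul_of_nonneg_left (hx k) hr.le).trans_eq ?_)
      push_cast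
      ring) hsum
  rw [Real.finsetProd_rpow _ _ fun k _ => by positivity]
  have hpow : ((u ^ 2 + v ^ 2) / (2 * q)) ^ (2 * q)
      ≤ ∏ k, (1 + (u * x k + v / Real.sqrt n) ^ 2) := by
    refine le_trans ?_ hprod
    push_cast
    gcongr
    linarith
  refine (Real.rpow_le_rpow_of_nonpos (by positivity) hpow (by norm_num)).trans_eq ?_
  rw [← div_pow, ← inv_div (u ^ 2 + v ^ 2), inv_pow, ← Real.rpow_natCast _ (2 * q),
    ← Real.rpow_mul (by positivity), ← Real.rpow_natCast _ q, ← Real.rpow_neg (by positivity)]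
  congr 1
  push_cast
  ring

/-- Outside the ball of radius `M ≥ 1`, the weight `|ξ| ^ (-2 * (ℓ + p + 2))` times `|ξ| ^ ℓ` is
dominated by `M ^ (-p)` times a product of Cauchy densities. -/
theorem sqrt_pow_div_pow_le {ℓ p : ℕ} {M : ℝ} (hM : 1 ≤ M) {u v : ℝ}
    (h : M < Real.sqrt (u ^ 2 + v ^ 2)) :
    Real.sqrt (u ^ 2 + v ^ 2) ^ ℓ / (u ^ 2 + v ^ 2) ^ (ℓ + p + 2)
      ≤ 4 / M ^ p * ((1 + u ^ 2)⁻¹ * (1 + v ^ 2)⁻¹) := by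
  set r := Real.sqrt (u ^ 2 + v ^ 2) with hr
  have hsq : u ^ 2 + v ^ 2 = r ^ 2 := (Real.sq_sqrt (by positivity)).symm
  have hr1 : 1 ≤ r := hM.trans h.le
  have hr2 : 1 ≤ r ^ 2 := one_le_pow₀ hr1
  have hM0 : 0 < M := by linarith
  have h4 : (1 + u ^ 2) * (1 + v ^ 2) ≤ 4 * r ^ 4 := by
    have := mul_le_mul (show 1 + u ^ 2 ≤ 2 * r ^ 2 by nlinarith [sq_nonneg v])
      (show 1 + v ^ 2 ≤ 2 * r ^ 2 by nlinarith [sq_nonneg u]) (by positivity) (by positivity)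
    linarith
  rw [hsq, ← mul_inv, ← div_eq_mul_inv, div_div, div_le_div_iff₀ (by positivity) (by positivity)]
  calc r ^ ℓ * (M ^ p * ((1 + u ^ 2) * (1 + v ^ 2))) ≤ r ^ ℓ * (r ^ p * (4 * r ^ 4)) := by
        gcongr
    _ = 4 * r ^ (ℓ + p + 4) := by ring
    _ ≤ 4 * r ^ (2 * (ℓ + p + 2)) := by
        gcongr 4 * ?_
        exact pow_le_pow_right₀ hr1 (by omega)
    _ = 4 * (r ^ 2) ^ (ℓ + p + 2) := by rw [← pow_mul]

/-- Khinchine-type tail estimate: the tail integral of `∏ (1+t_k²)^{-1/2}` with polynomial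
weight decays faster than any power of `M`. -/
theorem tail_integral_prod_bound (ℓ p : ℕ) :
    ∃ C > (0 : ℝ), ∃ ε > (0 : ℝ), ∃ N : ℕ, ∀ n : ℕ, N ≤ n →
      ∀ x : Fin n → ℝ,
        (∑ k, x k) = 0 → (∑ k, (x k) ^ 2) = 1 →
        (∑ k, ((x k) ^ 2 + 1 / n) ^ ((3 : ℝ) / 2)) ≤ ε →
        ∀ M : ℝ, 1 ≤ M →
          (∫ ξ in {ξ : ℝ × ℝ | M < Real.sqrt (ξ.1 ^ 2 + ξ.2 ^ 2)},
              Real.sqrt (ξ.1 ^ 2 + ξ.2 ^ 2) ^ ℓ *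
                ∏ k, (1 + (ξ.1 * x k + ξ.2 / Real.sqrt n) ^ 2) ^ (-(1 : ℝ) / 2))
            ≤ C / M ^ p := by
  set q : ℕ := ℓ + p + 2 with hq
  have hq0 : (0 : ℝ) < q := by positivity
  refine ⟨(2 * q) ^ q * 4 * (π * π), by positivity, (1 / (2 * q)) ^ ((3 : ℝ) / 2), by positivity,
    1, fun n hn x h0 h1 hε M hM => ?_⟩
  have hn' : (0 : ℝ) < n := by exact_mod_cast hn
  have hx (k : Fin n) : x k ^ 2 + 1 / n ≤ 1 / (2 * q) := by
    have := (Finset.single_le_sum (f := fun k => ((x k) ^ 2 + 1 / (n : ℝ)) ^ ((3 : ℝ) / 2))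
      (fun k _ => by positivity) (Finset.mem_univ k)).trans hε
    exact (Real.rpow_le_rpow_iff (by positivity) (by positivity) (by norm_num)).1 this
  set g : ℝ × ℝ → ℝ := fun ξ =>
    (2 * q) ^ q * (4 / M ^ p) * ((1 + ξ.1 ^ 2)⁻¹ * (1 + ξ.2 ^ 2)⁻¹) with hg
  have hgi : Integrable g :=
    (integrable_inv_one_add_sq.mul_prod integrable_inv_one_add_sq).const_mul _
  have hS : MeasurableSet {ξ : ℝ × ℝ | M < Real.sqrt (ξ.1 ^ 2 + ξ.2 ^ 2)} :=
    measurableSet_lt measurable_const (by fun_prop)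
  calc _ ≤ ∫ ξ in {ξ : ℝ × ℝ | M < Real.sqrt (ξ.1 ^ 2 + ξ.2 ^ 2)}, g ξ := by
        refine integral_mono_of_nonneg (ae_of_all _ fun ξ => by positivity) hgi.integrableOn ?_
        filter_upwards [ae_restrict_mem hS] with ξ hξ
        have hξ' : M < Real.sqrt (ξ.1 ^ 2 + ξ.2 ^ 2) := hξ
        have hr : 0 < ξ.1 ^ 2 + ξ.2 ^ 2 := Real.sqrt_pos.1 (by linarith)
        calc _ ≤ Real.sqrt (ξ.1 ^ 2 + ξ.2 ^ 2) ^ ℓ * ((2 * q) ^ q / (ξ.1 ^ 2 + ξ.2 ^ 2) ^ q) := by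
              gcongr
              exact prod_one_add_sq_rpow_le hn (by omega) h0 h1 hx _ _ hr
          _ = (2 * q) ^ q *
              (Real.sqrt (ξ.1 ^ 2 + ξ.2 ^ 2) ^ ℓ / (ξ.1 ^ 2 + ξ.2 ^ 2) ^ q) := by ring
          _ ≤ (2 * q) ^ q * (4 / M ^ p * ((1 + ξ.1 ^ 2)⁻¹ * (1 + ξ.2 ^ 2)⁻¹)) := by
              gcongr
              exact sqrt_pow_div_pow_le hM hξ'
          _ = g ξ := by rw [hg]; ring
    _ ≤ ∫ ξ, g ξ := setIntegral_le_integral hgi (ae_of_all _ fun ξ => by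
        have : 0 < M := by linarith
        simp only [hg, Pi.zero_apply]
        positivity)
    _ = (2 * q) ^ q * 4 * (π * π) / M ^ p := by
        rw [hg, integral_const_mul, Measure.volume_eq_prod,
          integral_prod_mul (fun u : ℝ => (1 + u ^ 2)⁻¹) (fun v : ℝ => (1 + v ^ 2)⁻¹),
          integral_univ_inv_one_add_sq]
        ring
end

section
/- Let ℓ be a nonnegative integer. There exist a constant C > 0, a real ε > 0 and a natural number N (depending only on ℓ) such that for every n ≥ N and every real sequence x_1, …, x_n with ∑ x_k = 0, ∑ x_k² = 1 and m³ := ∑_{k=1}^n (x_k² + 1/n)^{3/2} ≤ ε, one has ∬_{ℝ²} |ξ|^ℓ ( e^{F(ξ)} − e^{H(ξ)} ) dξ ≤ C m⁴, where F(ξ) = −(1/2) ∑_{k=1}^n ln(1 + t_k(ξ)²), H(ξ) = −|ξ|²/2, and t_k(ξ) = ξ_1 x_k + ξ_2 n^{−1/2}. (Note e^{F(ξ)} ≥ e^{H(ξ)} pointwise, so the integrand is nonnegative.) -/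
open Real Finset MeasureTheory

theorem sub_sq_div_two_le_log_one_add {s : ℝ} (hs : 0 ≤ s) : s - s ^ 2 / 2 ≤ log (1 + s) := by
  refine le_trans ?_ (Real.le_log_one_add_of_nonneg hs)
  rw [le_div_iff₀ (by positivity)]
  nlinarith [pow_nonneg hs 3]

/-- Concavity of `s ↦ log (1 + s)`, as a lower bound by the chord on `[0, M]`. -/
theorem mul_log_one_add_le_mul_log_one_add {s M : ℝ} (hs : 0 ≤ s) (hsM : s ≤ M) :
    s * log (1 + M) ≤ M * log (1 + s) := by
  rcases (hs.trans hsM).eq_or_lt with rfl | hM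
  · simp
  · have h := strictConcaveOn_log_Ioi.concaveOn.2
      (Set.mem_Ioi.2 one_pos) (Set.mem_Ioi.2 (show 0 < 1 + M by positivity))
      (sub_nonneg.2 ((div_le_one hM).2 hsM)) (show 0 ≤ s / M by positivity)
      (by ring)
    have e : (1 - s / M) • (1 : ℝ) + (s / M) • (1 + M) = 1 + s := by
      simp only [smul_eq_mul]; field_simp; ring
    rw [e] at h
    simp only [smul_eq_mul, log_one, mul_zero, zero_add] at h
    rw [div_mul_eq_mul_div, div_le_iff₀ hM] at h
    linarith

theorem mul_log_one_add_le_sum_log_one_add {ι : Type*} [Fintype ι] {s : ι → ℝ} {p M : ℝ}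
    (hs : ∀ k, 0 ≤ s k) (hsM : ∀ k, s k ≤ M) (hM : 0 ≤ M) (hsum : ∑ k, s k = p * M) :
    p * log (1 + M) ≤ ∑ k, log (1 + s k) := by
  rcases hM.eq_or_lt with rfl | hM
  · simpa using Finset.sum_nonneg fun k _ => log_nonneg (by linarith [hs k])
  · have h : ∑ k, s k * log (1 + M) ≤ ∑ k, M * log (1 + s k) :=
      Finset.sum_le_sum fun k _ => mul_log_one_add_le_mul_log_one_add (hs k) (hsM k)
    rw [← Finset.sum_mul, ← Finset.mul_sum, hsum] at h
    refine le_of_mul_le_mul_left (le_trans (le_of_eq ?_) h) hM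
    ring

theorem sum_sq_le_rpow_sum_rpow {ι : Type*} [Fintype ι] {b : ι → ℝ} (hb : ∀ k, 0 ≤ b k) :
    ∑ k, b k ^ 2 ≤ (∑ k, b k ^ ((3 : ℝ) / 2)) ^ ((4 : ℝ) / 3) := by
  set S := ∑ k, b k ^ ((3 : ℝ) / 2) with hS
  have hS0 : 0 ≤ S := Finset.sum_nonneg fun k _ => rpow_nonneg (hb k) _
  have h : ∀ k, b k ^ 2 ≤ b k ^ ((3 : ℝ) / 2) * S ^ ((1 : ℝ) / 3) := fun k => by
    have h1 : b k ^ ((3 : ℝ) / 2) ≤ S :=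
      Finset.single_le_sum (f := fun k => b k ^ ((3 : ℝ) / 2))
        (fun k _ => rpow_nonneg (hb k) _) (Finset.mem_univ k)
    have h2 : b k ^ 2 = b k ^ ((3 : ℝ) / 2) * (b k ^ ((3 : ℝ) / 2)) ^ ((1 : ℝ) / 3) := by
      rw [← rpow_mul (hb k), ← rpow_add_of_nonneg (hb k) (by norm_num) (by norm_num),
        ← rpow_natCast]
      norm_num
    rw [h2]
    exact mul_le_mul_of_nonneg_left (rpow_le_rpow (rpow_nonneg (hb k) _) h1 (by norm_num))
      (rpow_nonneg (hb k) _)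
  calc ∑ k, b k ^ 2 ≤ ∑ k, b k ^ ((3 : ℝ) / 2) * S ^ ((1 : ℝ) / 3) :=
        Finset.sum_le_sum fun k _ => h k
    _ = S ^ (1 : ℝ) * S ^ ((1 : ℝ) / 3) := by rw [← Finset.sum_mul, ← hS, rpow_one]
    _ = S ^ ((4 : ℝ) / 3) := by
        rw [← rpow_add_of_nonneg hS0 (by norm_num) (by norm_num)]; norm_num

theorem integrable_inv_one_add_sq_mul_inv_one_add_sq :
    Integrable fun ξ : ℝ × ℝ => (1 + ξ.1 ^ 2)⁻¹ * (1 + ξ.2 ^ 2)⁻¹ :=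
  integrable_inv_one_add_sq.mul_prod integrable_inv_one_add_sq

/-- The pointwise comparison of `∏ (1 + s k)^(-1/2)` with the Gaussian `e^{-Q/2}`, where
`Q = ∑ s k`, when each `s k` is at most a fraction `b k ≤ 1 / (2 q)` of `Q`. -/
theorem exp_neg_half_sum_log_sub_exp_le {ι : Type*} [Fintype ι] {s b : ι → ℝ} {Q : ℝ} {q : ℕ}
    (hq : 0 < q) (hQ : 0 ≤ Q) (hs : ∀ k, 0 ≤ s k) (hsb : ∀ k, s k ≤ b k * Q)
    (hb : ∀ k, b k ≤ 1 / (2 * q)) (hsum : ∑ k, s k = Q) :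
    exp (-(1 / 2) * ∑ k, log (1 + s k)) - exp (-Q / 2)
      ≤ Q ^ 2 / 4 * (∑ k, b k ^ 2) * ((2 * q) ^ q * ((1 + Q) ^ q)⁻¹) := by
  set F := -(1 / 2) * ∑ k, log (1 + s k) with hF
  have hq' : (1 : ℝ) ≤ q := by exact_mod_cast hq
  have hgap : F - -Q / 2 ≤ Q ^ 2 / 4 * ∑ k, b k ^ 2 := by
    have h1 : ∑ k, (s k - (b k * Q) ^ 2 / 2) ≤ ∑ k, log (1 + s k) :=
      Finset.sum_le_sum fun k _ => by
        have := pow_le_pow_left₀ (hs k) (hsb k) 2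
        linarith [sub_sq_div_two_le_log_one_add (hs k)]
    have h2 : ∑ k, (s k - (b k * Q) ^ 2 / 2) = Q - Q ^ 2 / 2 * ∑ k, b k ^ 2 := by
      rw [Finset.sum_sub_distrib, hsum, Finset.mul_sum]
      congr 1
      exact Finset.sum_congr rfl fun k _ => by ring
    rw [hF]
    linarith
  have hdecay : exp F ≤ (2 * q) ^ q * ((1 + Q) ^ q)⁻¹ := by
    have h1 : (2 * q : ℝ) * log (1 + Q / (2 * q)) ≤ ∑ k, log (1 + s k) := by
      refine mul_log_one_add_le_sum_log_one_add hs (fun k => ?_) (by positivity) ?_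
      · calc s k ≤ b k * Q := hsb k
          _ ≤ 1 / (2 * q) * Q := mul_le_mul_of_nonneg_right (hb k) hQ
          _ = Q / (2 * q) := by ring
      · rw [hsum]; field_simp
    have hpos : 0 < 1 + Q / (2 * q) := by positivity
    have h2 : exp (q * log (1 + Q / (2 * q))) = (1 + Q / (2 * q)) ^ q := by
      rw [exp_nat_mul, exp_log hpos]
    have h3 : (1 + Q) / (2 * q) ≤ 1 + Q / (2 * q) := by
      rw [add_div]
      gcongr
      rw [div_le_one (by positivity)]
      linarith
    calc exp F ≤ exp (-(q * log (1 + Q / (2 * q)))) := exp_le_exp.2 (by rw [hF]; linarith)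
      _ = ((1 + Q / (2 * q)) ^ q)⁻¹ := by rw [exp_neg, h2]
      _ ≤ (((1 + Q) / (2 * q)) ^ q)⁻¹ := by gcongr
      _ = (2 * q) ^ q * ((1 + Q) ^ q)⁻¹ := by rw [div_pow, inv_div, div_eq_mul_inv]
  have hconv : exp F - exp (-Q / 2) ≤ (F - -Q / 2) * exp F := by
    have h1 := add_one_le_exp (-Q / 2 - F)
    have h2 : exp (-Q / 2) = exp (-Q / 2 - F) * exp F := by rw [← exp_add]; ring_nf
    rw [h2]
    nlinarith [exp_pos F]
  calc exp F - exp (-Q / 2) ≤ (F - -Q / 2) * exp F := hconv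
    _ ≤ (Q ^ 2 / 4 * ∑ k, b k ^ 2) * exp F := by gcongr
    _ ≤ _ := by gcongr

theorem exp_neg_half_le_exp_neg_half_sum_log {ι : Type*} [Fintype ι] {s : ι → ℝ}
    (hs : ∀ k, 0 ≤ s k) :
    exp (-(∑ k, s k) / 2) ≤ exp (-(1 / 2) * ∑ k, log (1 + s k)) := by
  have h : ∑ k, log (1 + s k) ≤ ∑ k, s k := Finset.sum_le_sum fun k _ => by
    linarith [log_le_sub_one_of_pos (show 0 < 1 + s k by linarith [hs k])]
  exact exp_le_exp.2 (by linarith)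

theorem sqrt_pow_mul_sq_mul_inv_one_add_pow_le (ℓ : ℕ) (a b : ℝ) :
    √(a ^ 2 + b ^ 2) ^ ℓ * (a ^ 2 + b ^ 2) ^ 2 * ((1 + (a ^ 2 + b ^ 2)) ^ (ℓ + 4))⁻¹
      ≤ (1 + a ^ 2)⁻¹ * (1 + b ^ 2)⁻¹ := by
  set Q := a ^ 2 + b ^ 2 with hQ
  have hQ0 : 0 ≤ Q := by positivity
  have h1 : √Q ≤ 1 + Q := by
    nlinarith [sq_sqrt hQ0, sq_nonneg (√Q - 1), sqrt_nonneg Q]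
  have h2 : √Q ^ ℓ * Q ^ 2 ≤ (1 + Q) ^ ℓ * (1 + Q) ^ 2 := by
    gcongr
    linarith
  have h3 : (1 + a ^ 2) * (1 + b ^ 2) ≤ (1 + Q) ^ 2 := by
    rw [hQ]; nlinarith [sq_nonneg a, sq_nonneg b, mul_nonneg (sq_nonneg a) (sq_nonneg b)]
  calc √Q ^ ℓ * Q ^ 2 * ((1 + Q) ^ (ℓ + 4))⁻¹
      ≤ (1 + Q) ^ ℓ * (1 + Q) ^ 2 * ((1 + Q) ^ (ℓ + 4))⁻¹ := by gcongr
    _ = ((1 + Q) ^ 2)⁻¹ := by field_simp; ring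
    _ ≤ ((1 + a ^ 2) * (1 + b ^ 2))⁻¹ := by gcongr
    _ = _ := mul_inv _ _

theorem sum_sq_linear_form {n : ℕ} (hn : 0 < n) {x : Fin n → ℝ} (h0 : ∑ k, x k = 0)
    (h1 : ∑ k, x k ^ 2 = 1) (a b : ℝ) : ∑ k, (a * x k + b / √n) ^ 2 = a ^ 2 + b ^ 2 := by
  have hn' : (0 : ℝ) < n := by exact_mod_cast hn
  have h : ∀ k, (a * x k + b / √n) ^ 2
      = a ^ 2 * x k ^ 2 + 2 * a * b / √n * x k + b ^ 2 / n := fun k => by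
    have : (b / √n) ^ 2 = b ^ 2 / n := by rw [div_pow, sq_sqrt hn'.le]
    rw [← this]; ring
  simp only [h, Finset.sum_add_distrib, ← Finset.mul_sum, h0, h1, Finset.sum_const,
    Finset.card_univ, Fintype.card_fin, nsmul_eq_mul]
  field_simp
  ring

theorem sq_linear_form_le {n : ℕ} (x a b : ℝ) :
    (a * x + b / √n) ^ 2 ≤ (x ^ 2 + 1 / n) * (a ^ 2 + b ^ 2) := by
  have h : (1 : ℝ) / n = (1 / √n) ^ 2 := by rw [div_pow, sq_sqrt n.cast_nonneg, one_pow]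
  rw [h]
  have e : b / √n = b * (1 / √n) := by ring
  rw [e]
  nlinarith [sq_nonneg (a * (1 / √n) - b * x)]

/-- `∬ |ξ|^ℓ (e^F - e^H) dξ ≲ m⁴`, where `e^F` is the modulus of the characteristic function
`∏ (1+t_k²)^{-1/2}` and `e^H` the Gaussian `e^{-|ξ|²/2}`. -/
theorem integral_expF_sub_expH_bound (ℓ : ℕ) :
    ∃ C > (0 : ℝ), ∃ ε > (0 : ℝ), ∃ N : ℕ, ∀ n : ℕ, N ≤ n →
      ∀ x : Fin n → ℝ,
        (∑ k, x k) = 0 → (∑ k, (x k) ^ 2) = 1 →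
        (∑ k, ((x k) ^ 2 + 1 / n) ^ ((3 : ℝ) / 2)) ≤ ε →
        (∫ ξ : ℝ × ℝ,
            Real.sqrt (ξ.1 ^ 2 + ξ.2 ^ 2) ^ ℓ *
              (Real.exp (-(1 / 2) * ∑ k, Real.log (1 + (ξ.1 * x k + ξ.2 / Real.sqrt n) ^ 2)) -
                Real.exp (-(ξ.1 ^ 2 + ξ.2 ^ 2) / 2)))
          ≤ C * (∑ k, ((x k) ^ 2 + 1 / n) ^ ((3 : ℝ) / 2)) ^ ((4 : ℝ) / 3) := by
  set q : ℕ := ℓ + 4 with hq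
  have hq0 : 0 < q := by omega
  set g : ℝ × ℝ → ℝ := fun ξ => (1 + ξ.1 ^ 2)⁻¹ * (1 + ξ.2 ^ 2)⁻¹ with hg
  set A : ℝ := (2 * q) ^ q / 4 with hA
  have hA0 : 0 ≤ A := by positivity
  have hI : 0 ≤ ∫ ξ, g ξ := integral_nonneg fun ξ => by simp only [hg]; positivity
  refine ⟨A * (∫ ξ, g ξ) + 1, by positivity, (1 / (2 * q)) ^ ((3 : ℝ) / 2), by positivity, 1,
    fun n hn x h0 h1 hε => ?_⟩
  set m4 := (∑ k, (x k ^ 2 + 1 / n) ^ ((3 : ℝ) / 2)) ^ ((4 : ℝ) / 3) with hm4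
  have hb0 : ∀ k, 0 ≤ x k ^ 2 + 1 / (n : ℝ) := fun k => by positivity
  have hm0 : 0 ≤ m4 := rpow_nonneg (Finset.sum_nonneg fun k _ => rpow_nonneg (hb0 k) _) _
  have hb : ∀ k, x k ^ 2 + 1 / (n : ℝ) ≤ 1 / (2 * q) := fun k => by
    rw [← rpow_le_rpow_iff (hb0 k) (by positivity) (show (0 : ℝ) < 3 / 2 by norm_num)]
    exact (Finset.single_le_sum (f := fun k => (x k ^ 2 + 1 / (n : ℝ)) ^ ((3 : ℝ) / 2))
      (fun k _ => rpow_nonneg (hb0 k) _) (Finset.mem_univ k)).trans hε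
  have hbound : ∀ ξ : ℝ × ℝ, √(ξ.1 ^ 2 + ξ.2 ^ 2) ^ ℓ *
      (exp (-(1 / 2) * ∑ k, log (1 + (ξ.1 * x k + ξ.2 / √n) ^ 2)) -
        exp (-(ξ.1 ^ 2 + ξ.2 ^ 2) / 2)) ≤ A * m4 * g ξ := fun ξ => by
    have hdiff := exp_neg_half_sum_log_sub_exp_le hq0 (by positivity)
      (fun k => sq_nonneg (ξ.1 * x k + ξ.2 / √n))
      (fun k => sq_linear_form_le (x k) ξ.1 ξ.2) hb (sum_sq_linear_form hn h0 h1 ξ.1 ξ.2)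
    have hdecay := sqrt_pow_mul_sq_mul_inv_one_add_pow_le ℓ ξ.1 ξ.2
    set Q := ξ.1 ^ 2 + ξ.2 ^ 2 with hQ
    have hQ0 : 0 ≤ Q := by positivity
    calc _ ≤ √Q ^ ℓ * (Q ^ 2 / 4 * (∑ k, (x k ^ 2 + 1 / (n : ℝ)) ^ 2) *
          ((2 * q) ^ q * ((1 + Q) ^ q)⁻¹)) := by gcongr
      _ ≤ √Q ^ ℓ * (Q ^ 2 / 4 * m4 * ((2 * q) ^ q * ((1 + Q) ^ q)⁻¹)) := by
          gcongr
          exact sum_sq_le_rpow_sum_rpow hb0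
      _ = A * m4 * (√Q ^ ℓ * Q ^ 2 * ((1 + Q) ^ q)⁻¹) := by rw [hA]; ring
      _ ≤ A * m4 * g ξ := by gcongr
  calc _ ≤ ∫ ξ, A * m4 * g ξ := by
        refine integral_mono_of_nonneg (Filter.Eventually.of_forall fun ξ => ?_)
          (integrable_inv_one_add_sq_mul_inv_one_add_sq.const_mul _)
          (Filter.Eventually.of_forall hbound)
        have h := exp_neg_half_le_exp_neg_half_sum_log
          fun k => sq_nonneg (ξ.1 * x k + ξ.2 / √n)
        rw [sum_sq_linear_form hn h0 h1] at h
        exact mul_nonneg (by positivity) (sub_nonneg.2 h)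
    _ = A * (∫ ξ, g ξ) * m4 := by rw [integral_const_mul]; ring
    _ ≤ (A * (∫ ξ, g ξ) + 1) * m4 := by gcongr; linarith
end

section
/- For every integer r ≥ 1 there exist a constant C_r and a natural number d_r such that for every b ∈ {1, 2}, every n, every real sequence x_1, …, x_n with ∑ x_k = 0 and ∑ x_k² = 1, and every ξ ∈ ℝ², one has |∂_{ξ_b}^r ( F − H )(ξ)| ≤ C_r (1 + |ξ|)^{d_r} · m³, where F(ξ) = −(1/2) ∑_{k=1}^n ln(1 + t_k(ξ)²), H(ξ) = −|ξ|²/2, t_k(ξ) = ξ_1 x_k + ξ_2 n^{−1/2}, and m³ = ∑_{k=1}^n (x_k² + 1/n)^{3/2}. -/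
open Real Finset

/-- The difference between the quadratic `t² / 2` and `log (1 + t²) / 2`. -/
noncomputable def logRemainder (t : ℝ) : ℝ := (t ^ 2 - Real.log (1 + t ^ 2)) / 2

theorem contDiff_logRemainder {m : WithTop ℕ∞} : ContDiff ℝ m logRemainder := by
  unfold logRemainder
  have h : ContDiff ℝ m fun t : ℝ => Real.log (1 + t ^ 2) :=
    (contDiff_const.add (contDiff_id.pow 2)).log fun t => by
      have := sq_nonneg t
      simp only [id]
      positivity
  exact ((contDiff_id.pow 2).sub h).div_const 2

theorem hasDerivAt_logRemainder (t : ℝ) :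
    HasDerivAt logRemainder (t ^ 3 / (1 + t ^ 2)) t := by
  have hpos : 1 + t ^ 2 ≠ 0 := by positivity
  have h := (((hasDerivAt_pow 2 t).sub
    (((hasDerivAt_pow 2 t).const_add 1).log hpos)).div_const 2)
  refine h.congr_deriv ?_
  field_simp
  ring

/-- The derivatives of `logRemainder` are rational with denominator a power of `1 + t²`, and
vanish at the origin to the order of the Taylor remainder. -/
theorem exists_iteratedDeriv_logRemainder_eq (r : ℕ) :
    ∃ P : Polynomial ℝ, Polynomial.X ^ (3 - (r + 1)) ∣ P ∧
      iteratedDeriv (r + 1) logRemainder = fun t => P.eval t / (1 + t ^ 2) ^ (r + 1) := by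
  induction r with
  | zero =>
    refine ⟨Polynomial.X ^ 3, pow_dvd_pow _ (by norm_num), ?_⟩
    funext t
    simp [iteratedDeriv_one, (hasDerivAt_logRemainder t).deriv]
  | succ r ih =>
    obtain ⟨P, hP, h⟩ := ih
    refine ⟨P.derivative * (1 + Polynomial.X ^ 2)
      - Polynomial.C (2 * ((r : ℝ) + 1)) * Polynomial.X * P, ?_, ?_⟩
    · refine dvd_sub (Dvd.dvd.mul_right ?_ _) (Dvd.dvd.mul_left ?_ _)
      · have := Polynomial.pow_sub_one_dvd_derivative_of_pow_dvd hP
        rwa [Nat.sub_sub] at this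
      · exact (pow_dvd_pow _ (by lia)).trans hP
    · rw [iteratedDeriv_succ, h]
      funext t
      have hpos : 1 + t ^ 2 ≠ 0 := by positivity
      have hd := (P.hasDerivAt t).div
        (((hasDerivAt_pow 2 t).const_add 1).pow (r + 1)) (pow_ne_zero _ hpos)
      refine hd.deriv.trans ?_
      simp only [Polynomial.eval_sub, Polynomial.eval_mul, Polynomial.eval_add,
        Polynomial.eval_one, Polynomial.eval_pow, Polynomial.eval_X, Polynomial.eval_C,
        Pi.pow_apply, Nat.add_sub_cancel, Nat.cast_add, Nat.cast_one]
      field_simp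
      push_cast
      ring

theorem Polynomial.exists_abs_eval_le (P : Polynomial ℝ) :
    ∃ C : ℝ, 0 < C ∧ ∀ t : ℝ, |P.eval t| ≤ C * (1 + |t|) ^ P.natDegree := by
  refine ⟨∑ i ∈ range (P.natDegree + 1), |P.coeff i| + 1, by positivity, fun t => ?_⟩
  have h1 : (1 : ℝ) ≤ 1 + |t| := by simp
  calc |P.eval t| ≤ ∑ i ∈ range (P.natDegree + 1), |P.coeff i * t ^ i| := by
        rw [Polynomial.eval_eq_sum_range]
        exact abs_sum_le_sum_abs _ _
    _ ≤ ∑ i ∈ range (P.natDegree + 1), |P.coeff i| * (1 + |t|) ^ P.natDegree := by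
        refine sum_le_sum fun i hi => ?_
        rw [abs_mul, abs_pow]
        gcongr
        calc |t| ^ i ≤ (1 + |t|) ^ i := by gcongr; simp
          _ ≤ _ := pow_le_pow_right₀ h1 (by simpa [Nat.lt_succ_iff] using hi)
    _ ≤ _ := by
        rw [← sum_mul]
        gcongr
        simp

theorem exists_abs_iteratedDeriv_logRemainder_le {r : ℕ} (hr : 1 ≤ r) :
    ∃ C : ℝ, 0 < C ∧ ∃ d : ℕ, ∀ t : ℝ,
      |iteratedDeriv r logRemainder t| ≤ C * |t| ^ (3 - r) * (1 + |t|) ^ d := by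
  obtain ⟨r, rfl⟩ := Nat.exists_eq_add_of_le' hr
  obtain ⟨P, ⟨Q, rfl⟩, h⟩ := exists_iteratedDeriv_logRemainder_eq r
  obtain ⟨C, hC, hQ⟩ := Q.exists_abs_eval_le
  refine ⟨C, hC, Q.natDegree, fun t => ?_⟩
  have hone : (1 : ℝ) ≤ (1 + t ^ 2) ^ (r + 1) := one_le_pow₀ (by nlinarith [sq_nonneg t])
  simp only [h, abs_div, abs_of_pos (zero_lt_one.trans_le hone)]
  refine (div_le_self (abs_nonneg _) hone).trans ?_
  rw [Polynomial.eval_mul, Polynomial.eval_pow, Polynomial.eval_X, abs_mul, abs_pow]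
  calc _ ≤ |t| ^ (3 - (r + 1)) * (C * (1 + |t|) ^ Q.natDegree) := by gcongr; exact hQ t
    _ = _ := by ring

theorem iteratedDeriv_sum_comp_affine {ι : Type*} [Fintype ι] {f : ℝ → ℝ} {r : ℕ}
    (hf : ContDiff ℝ r f) (a c : ι → ℝ) (s : ℝ) :
    iteratedDeriv r (fun u => ∑ k, f (a k * u + c k)) s
      = ∑ k, a k ^ r * iteratedDeriv r f (a k * s + c k) := by
  rw [iteratedDeriv_fun_sum fun k _ => ContDiff.contDiffAt (by fun_prop)]
  refine sum_congr rfl fun k _ => ?_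
  have h : ContDiff ℝ r fun u => f (u + c k) := by fun_prop
  rw [iteratedDeriv_comp_const_mul h, iteratedDeriv_comp_add_const]

theorem abs_iteratedDeriv_sum_comp_affine_le {ι : Type*} [Fintype ι] {f : ℝ → ℝ} {r d : ℕ}
    {C : ℝ} (hf : ContDiff ℝ r f) (hC : 0 ≤ C)
    (hb : ∀ t, |iteratedDeriv r f t| ≤ C * |t| ^ (3 - r) * (1 + |t|) ^ d)
    {a c w : ι → ℝ} {R s : ℝ} (hR : 0 ≤ R) (hw : ∀ k, w k ≤ 2) (ha : ∀ k, |a k| ≤ w k)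
    (ht : ∀ k, |a k * s + c k| ≤ w k * R) :
    |iteratedDeriv r (fun u => ∑ k, f (a k * u + c k)) s|
      ≤ C * 2 ^ (r - 3) * 2 ^ d * (1 + R) ^ (3 - r + d) * ∑ k, w k ^ 3 := by
  rw [iteratedDeriv_sum_comp_affine hf, mul_sum]
  refine (abs_sum_le_sum_abs _ _).trans (sum_le_sum fun k _ => ?_)
  have hw0 : 0 ≤ w k := (abs_nonneg _).trans (ha k)
  have hexp : r + (3 - r) = 3 + (r - 3) := by lia
  have hbase : 1 + |a k * s + c k| ≤ 2 * (1 + R) := by nlinarith [ht k, hw k]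
  rw [abs_mul, abs_pow]
  calc |a k| ^ r * |iteratedDeriv r f (a k * s + c k)|
      ≤ w k ^ r * (C * (w k * R) ^ (3 - r) * (2 * (1 + R)) ^ d) := by
        gcongr
        · exact ha k
        · exact (hb _).trans (by gcongr; exact ht k)
    _ = C * (w k ^ (r + (3 - r)) * R ^ (3 - r)) * (2 * (1 + R)) ^ d := by
        rw [pow_add, mul_pow (w k)]
        ring
    _ ≤ C * (w k ^ 3 * 2 ^ (r - 3) * (1 + R) ^ (3 - r)) * (2 * (1 + R)) ^ d := by
        rw [hexp, pow_add]
        gcongr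
        · exact hw k
        · linarith
    _ = _ := by
        rw [mul_pow, pow_add]
        ring

theorem sum_logRemainder_eq {n : ℕ} {x : Fin n → ℝ} (h0 : ∑ k, x k = 0)
    (h1 : ∑ k, x k ^ 2 = 1) (a b : ℝ) :
    (-(1 / 2) * ∑ k, Real.log (1 + (a * x k + b / √n) ^ 2)) - (-(a ^ 2 + b ^ 2) / 2)
      = ∑ k, logRemainder (a * x k + b / √n) := by
  have hn : (n : ℝ) ≠ 0 := by
    rintro h
    obtain rfl : n = 0 := by exact_mod_cast h
    simp at h1
  have hsq : ∑ k, (a * x k + b / √n) ^ 2 = a ^ 2 + b ^ 2 := by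
    have : ∀ k, (a * x k + b / √n) ^ 2
        = a ^ 2 * x k ^ 2 + 2 * a * (b / √n) * x k + b ^ 2 / n := fun k => by
      rw [add_sq, div_pow, Real.sq_sqrt (Nat.cast_nonneg n)]
      ring
    simp only [this, sum_add_distrib, ← mul_sum, h0, h1, sum_const, card_univ, Fintype.card_fin,
      nsmul_eq_mul]
    field_simp
    ring
  simp only [logRemainder, ← sum_div, sum_sub_distrib, hsq]
  ring

theorem abs_mul_add_mul_le_sqrt (a b c d : ℝ) :
    |a * b + c * d| ≤ √(b ^ 2 + d ^ 2) * √(a ^ 2 + c ^ 2) := by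
  rw [← Real.sqrt_mul (by positivity)]
  exact Real.abs_le_sqrt (by nlinarith [sq_nonneg (a * d - b * c)])

/-- Bound on the `r`-th partial derivatives (in either coordinate of `ξ ∈ ℝ²`) of
`F - H`, where `F(ξ) = -(1/2)∑ log(1+t_k²)` and `H(ξ) = -|ξ|²/2`:
`|∂_b^r (F-H)(ξ)| ≤ C_r (1+|ξ|)^{d_r} m³`. -/
theorem deriv_F_sub_H_bound (r : ℕ) (hr : 1 ≤ r) :
    ∃ C : ℝ, 0 < C ∧ ∃ d : ℕ,
      ∀ n : ℕ, ∀ x : Fin n → ℝ,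
        (∑ k, x k) = 0 → (∑ k, (x k) ^ 2) = 1 →
        ∀ ξ : ℝ × ℝ,
          (let FH : ℝ × ℝ → ℝ := fun ζ =>
            (-(1 / 2) * ∑ k, Real.log (1 + (ζ.1 * x k + ζ.2 / Real.sqrt n) ^ 2)) -
              (-(ζ.1 ^ 2 + ζ.2 ^ 2) / 2);
          |iteratedDeriv r (fun s => FH (s, ξ.2)) ξ.1|
              ≤ C * (1 + Real.sqrt (ξ.1 ^ 2 + ξ.2 ^ 2)) ^ d *
                ∑ k, ((x k) ^ 2 + 1 / n) ^ ((3 : ℝ) / 2) ∧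
            |iteratedDeriv r (fun s => FH (ξ.1, s)) ξ.2|
              ≤ C * (1 + Real.sqrt (ξ.1 ^ 2 + ξ.2 ^ 2)) ^ d *
                ∑ k, ((x k) ^ 2 + 1 / n) ^ ((3 : ℝ) / 2)) := by
  obtain ⟨C, hC, d, hb⟩ := exists_abs_iteratedDeriv_logRemainder_le hr
  refine ⟨C * 2 ^ (r - 3) * 2 ^ d, by positivity, 3 - r + d, fun n x h0 h1 ξ => ?_⟩
  simp only [sum_logRemainder_eq h0 h1]
  have hinv : (1 / √n : ℝ) ^ 2 = 1 / n := by
    rw [div_pow, Real.sq_sqrt (Nat.cast_nonneg n), one_pow]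
  have hcube : ∀ k, ((x k) ^ 2 + 1 / (n : ℝ)) ^ ((3 : ℝ) / 2)
      = √((x k) ^ 2 + (1 / √n) ^ 2) ^ 3 := fun k => by
    rw [hinv, Real.sqrt_eq_rpow, ← Real.rpow_mul_natCast (by positivity)]
    norm_num
  have hw : ∀ k, √((x k) ^ 2 + (1 / √n) ^ 2) ≤ 2 := fun k => by
    have hx : x k ^ 2 ≤ 1 := h1 ▸ single_le_sum (f := fun k => x k ^ 2)
      (fun i _ => sq_nonneg (x i)) (mem_univ k)
    have hn : (1 : ℝ) / n ≤ 1 := by simpa using Nat.cast_inv_le_one n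
    rw [hinv, Real.sqrt_le_left (by norm_num)]
    linarith
  have ht : ∀ k, |ξ.1 * x k + ξ.2 * (1 / √n)|
      ≤ √((x k) ^ 2 + (1 / √n) ^ 2) * √(ξ.1 ^ 2 + ξ.2 ^ 2) := fun k =>
    abs_mul_add_mul_le_sqrt ..
  simp only [hcube]
  constructor
  · have := abs_iteratedDeriv_sum_comp_affine_le contDiff_logRemainder hC.le hb
      (a := x) (c := fun _ => ξ.2 / √n) (s := ξ.1) (Real.sqrt_nonneg (ξ.1 ^ 2 + ξ.2 ^ 2)) hw
      (fun k => Real.abs_le_sqrt (by simp))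
      (fun k => by convert ht k using 2; ring)
    simpa only [mul_comm (x _)] using this
  · have := abs_iteratedDeriv_sum_comp_affine_le contDiff_logRemainder hC.le hb
      (a := fun _ => 1 / √n) (c := fun k => ξ.1 * x k) (s := ξ.2)
      (Real.sqrt_nonneg (ξ.1 ^ 2 + ξ.2 ^ 2)) hw
      (fun k => Real.abs_le_sqrt (by simp [sq_nonneg]))
      (fun k => by convert ht k using 2; ring)
    simpa only [one_div_mul_eq_div, add_comm (_ / √n)] using this
end

section
/- Let p, q be nonnegative integers. There exist a constant C > 0 and a natural number N (depending only on p and q) such that for every n ≥ N the following holds: if N_1, N_2 are independent standard normal random variables, ρ(t) = (2π)^{−1/2} e^{−t²/2} is the standard normal density, and h(t) = ∫_ℝ |y| ρ(t y) ρ(n^{1/2}(y − 1)) n^{1/2} dy is the density of N_1/(1 + n^{−1/2} N_2), then for every real t with |t| ≤ n, | t^p ∂_t^q ( ρ − h )(t) | ≤ C n^{−1/2}. -/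
open Real MeasureTheory

open ProbabilityTheory SchwartzMap

/-- A monomial times the Gaussian is bounded. -/
lemma exists_abs_pow_mul_gaussian_le (m : ℕ) :
    ∃ C, ∀ x : ℝ, |x| ^ m * rexp (-(x ^ 2 / 2)) ≤ C := by
  let g : ZeroAtInftyContinuousMap ℝ ℝ :=
    ⟨⟨fun x => |x| ^ m * rexp (-(x ^ 2 / 2)), by fun_prop⟩, by
      have := tendsto_rpow_abs_mul_exp_neg_mul_sq_cocompact (a := 1 / 2) (by norm_num) m
      simpa [Real.rpow_natCast, div_eq_inv_mul] using this⟩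
  exact ⟨‖g.toBCF‖, fun x => (le_abs_self _).trans (g.toBCF.norm_coe_le_norm x)⟩

/-- A polynomial times the Gaussian is rapidly decaying. -/
lemma exists_abs_pow_mul_polynomial_mul_gaussian_le (k : ℕ) (P : Polynomial ℝ) :
    ∃ C, ∀ x : ℝ, |x| ^ k * |P.eval x * rexp (-(x ^ 2 / 2))| ≤ C := by
  induction P using Polynomial.induction_on' with
  | add P Q hP hQ =>
    obtain ⟨A, hA⟩ := hP
    obtain ⟨B, hB⟩ := hQ
    refine ⟨A + B, fun x => ?_⟩
    rw [Polynomial.eval_add, add_mul]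
    calc _ ≤ |x| ^ k * (|P.eval x * rexp (-(x ^ 2 / 2))| + |Q.eval x * rexp (-(x ^ 2 / 2))|) := by
          gcongr
          exact abs_add_le _ _
      _ ≤ A + B := by linarith [hA x, hB x]
  | monomial j a =>
    obtain ⟨A, hA⟩ := exists_abs_pow_mul_gaussian_le (k + j)
    refine ⟨|a| * A, fun x => ?_⟩
    calc _ = |a| * (|x| ^ (k + j) * rexp (-(x ^ 2 / 2))) := by
          simp only [Polynomial.eval_monomial, abs_mul, abs_pow, abs_exp]
          ring
      _ ≤ |a| * A := by
          gcongr
          exact hA x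

/-- The standard normal density as a Schwartz function. -/
noncomputable def stdGaussianDensity : 𝓢(ℝ, ℝ) where
  toFun u := (1 / Real.sqrt (2 * π)) * Real.exp (-u ^ 2 / 2)
  smooth' := by fun_prop
  decay' k j := by
    obtain ⟨C, hC⟩ := exists_abs_pow_mul_polynomial_mul_gaussian_le k
      ((Polynomial.hermite j).map (Int.castRingHom ℝ))
    refine ⟨(1 / Real.sqrt (2 * π)) * C, fun x => ?_⟩
    have h : iteratedDeriv j (fun u : ℝ => (1 / Real.sqrt (2 * π)) * Real.exp (-u ^ 2 / 2)) x =
        (1 / Real.sqrt (2 * π)) * ((-1) ^ j *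
          (((Polynomial.hermite j).map (Int.castRingHom ℝ)).eval x * rexp (-(x ^ 2 / 2)))) := by
      rw [iteratedDeriv_const_mul_field, iteratedDeriv_eq_iterate]
      simp only [neg_div]
      rw [Polynomial.deriv_gaussian_eq_hermite_mul_gaussian, Polynomial.aeval_def,
        Polynomial.eval_map, mul_assoc]
      rfl
    rw [norm_iteratedFDeriv_eq_norm_iteratedDeriv, h, norm_mul, norm_mul,
      Real.norm_of_nonneg (by positivity : 0 ≤ 1 / √(2 * π)), mul_left_comm]
    gcongr
    simpa using hC x

lemma stdGaussianDensity_apply (u : ℝ) :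
    stdGaussianDensity u = (1 / Real.sqrt (2 * π)) * Real.exp (-u ^ 2 / 2) := rfl

lemma integral_gaussianReal_zero_one (g : ℝ → ℝ) :
    ∫ x, g x ∂(gaussianReal 0 1) = ∫ x, g x * stdGaussianDensity x := by
  rw [integral_gaussianReal_eq_integral_smul one_ne_zero]
  simp [gaussianPDFReal_def, stdGaussianDensity_apply, mul_comm]

/-- Integration against the normal density of mean `1` and standard deviation `c⁻¹`. -/
lemma integral_mul_rescaled_stdGaussianDensity (g : ℝ → ℝ) {c : ℝ} (hc : 0 < c) :
    ∫ y, g y * (c * stdGaussianDensity (c * (y - 1))) =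
      ∫ x, g (1 + c⁻¹ * x) ∂(gaussianReal 0 1) := by
  rw [integral_gaussianReal_zero_one]
  have h1 := integral_sub_right_eq_self (μ := volume)
    (fun z : ℝ => g (1 + z) * stdGaussianDensity (c * z)) (1 : ℝ)
  have h2 := Measure.integral_comp_mul_left
    (fun x : ℝ => g (1 + c⁻¹ * x) * stdGaussianDensity x) c
  simp only [add_sub_cancel] at h1
  simp only [inv_mul_cancel_left₀ hc.ne', abs_of_pos (inv_pos.2 hc), smul_eq_mul] at h2
  simp only [mul_left_comm _ c]
  rw [integral_const_mul, h1, h2, mul_inv_cancel_left₀ hc.ne']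

/-- All moments of an affine image of a standard normal variable are finite. -/
lemma integrable_abs_affine_pow_gaussianReal (a b : ℝ) (k : ℕ) :
    Integrable (fun x => |a + b * x| ^ k) (gaussianReal 0 1) := by
  have h : MemLp (fun x : ℝ => a + b * x) k (gaussianReal 0 1) :=
    (memLp_const a).add ((memLp_id_gaussianReal' k (by simp)).const_mul b)
  simpa using h.integrable_norm_pow'

namespace SchwartzMap

lemma exists_abs_pow_mul_iteratedDeriv_le (f : 𝓢(ℝ, ℝ)) (k j : ℕ) :
    ∃ C > 0, ∀ x, |x| ^ k * |iteratedDeriv j f x| ≤ C := by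
  obtain ⟨C, hC, h⟩ := f.decay k j
  refine ⟨C, hC, fun x => ?_⟩
  simpa [norm_iteratedFDeriv_eq_norm_iteratedDeriv] using h x

lemma exists_abs_iteratedDeriv_le (f : 𝓢(ℝ, ℝ)) (j : ℕ) :
    ∃ C > 0, ∀ x, |iteratedDeriv j f x| ≤ C := by
  simpa using f.exists_abs_pow_mul_iteratedDeriv_le 0 j

lemma hasDerivAt_iteratedDeriv (f : 𝓢(ℝ, ℝ)) (j : ℕ) (x : ℝ) :
    HasDerivAt (iteratedDeriv j f) (iteratedDeriv (j + 1) f x) x := by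
  rw [iteratedDeriv_succ]
  exact ((f.smooth (j + 1)).differentiable_iteratedDeriv j (by exact_mod_cast j.lt_succ_self)
    x).hasDerivAt

lemma continuous_iteratedDeriv (f : 𝓢(ℝ, ℝ)) (j : ℕ) : Continuous (iteratedDeriv j f) :=
  continuous_iff_continuousAt.2 fun x => (f.hasDerivAt_iteratedDeriv j x).continuousAt

variable {Ω : Type*} [MeasurableSpace Ω] {μ : Measure Ω} {Y : Ω → ℝ}

lemma integrable_abs_mul_pow_mul_iteratedDeriv (f : 𝓢(ℝ, ℝ)) (hY : Measurable Y)
    (hint : ∀ k : ℕ, Integrable (fun x => |Y x| ^ k) μ) (k : ℕ) (u : ℝ) :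
    Integrable (fun x => |Y x| * (Y x ^ k * iteratedDeriv k f (u * Y x))) μ := by
  obtain ⟨D, hD, hf⟩ := f.exists_abs_iteratedDeriv_le k
  have hm := (f.continuous_iteratedDeriv k).measurable
  refine ((hint (k + 1)).mul_const D).mono' (by fun_prop) (ae_of_all _ fun x => ?_)
  simp only [norm_mul, norm_pow, Real.norm_eq_abs, abs_abs]
  rw [← mul_assoc, ← pow_succ']
  gcongr
  exact hf _

/-- Differentiation under the integral sign for random dilations of a Schwartz function. -/
lemma iteratedDeriv_integral_abs_mul_dilation (f : 𝓢(ℝ, ℝ)) (hY : Measurable Y)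
    (hint : ∀ k : ℕ, Integrable (fun x => |Y x| ^ k) μ) (k : ℕ) :
    iteratedDeriv k (fun u => f u - ∫ x, |Y x| * f (u * Y x) ∂μ) = fun u =>
      iteratedDeriv k f u - ∫ x, |Y x| * (Y x ^ k * iteratedDeriv k f (u * Y x)) ∂μ := by
  induction k with
  | zero => simp
  | succ k ih =>
    rw [iteratedDeriv_succ, ih]
    ext u
    obtain ⟨D, hD, hf⟩ := f.exists_abs_iteratedDeriv_le (k + 1)
    refine ((f.hasDerivAt_iteratedDeriv k u).sub
      (hasDerivAt_integral_of_dominated_loc_of_deriv_le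
        (F' := fun u x => |Y x| * (Y x ^ (k + 1) * iteratedDeriv (k + 1) f (u * Y x)))
        (bound := fun x => |Y x| ^ (k + 2) * D) Filter.univ_mem
        (.of_forall fun v =>
          (f.integrable_abs_mul_pow_mul_iteratedDeriv hY hint k v).aestronglyMeasurable)
        (f.integrable_abs_mul_pow_mul_iteratedDeriv hY hint k u)
        (f.integrable_abs_mul_pow_mul_iteratedDeriv hY hint (k + 1) u).aestronglyMeasurable
        (ae_of_all _ fun x v _ => ?_) ((hint _).mul_const D)
        (ae_of_all _ fun x v _ => ?_)).2).deriv
    · simp only [norm_mul, norm_pow, Real.norm_eq_abs, abs_abs]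
      rw [← mul_assoc, ← pow_succ']
      gcongr
      exact hf _
    · have h := (((f.hasDerivAt_iteratedDeriv k (v * Y x)).comp v
        ((hasDerivAt_id v).mul_const (Y x))).const_mul (Y x ^ k)).const_mul |Y x|
      convert! h using 1
      ring

/-- Lipschitz estimate, near dilation factor `1`, for dilations of a Schwartz function. -/
lemma exists_abs_sub_dilation_le_of_abs_sub_one_le (f : 𝓢(ℝ, ℝ)) (p q : ℕ) :
    ∃ C > 0, ∀ t y : ℝ, |y - 1| ≤ 1 / 2 →
      |t| ^ p * |iteratedDeriv q f t - |y| * (y ^ q * iteratedDeriv q f (t * y))| ≤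
        C * |y - 1| := by
  obtain ⟨A, hA, hfA⟩ := f.exists_abs_pow_mul_iteratedDeriv_le p q
  obtain ⟨B, hB, hfB⟩ := f.exists_abs_pow_mul_iteratedDeriv_le (p + 1) (q + 1)
  refine ⟨(q + 1) * (3 / 2) ^ q * (2 ^ p * A) + (3 / 2) ^ (q + 1) * (2 ^ (p + 1) * B),
    by positivity, fun t y hy => ?_⟩
  have hs {y : ℝ} (hy : y ∈ Set.Icc (1 / 2 : ℝ) (3 / 2)) :
      |y| ≤ 3 / 2 ∧ |t| ≤ 2 * |t * y| := by
    have hy0 : 0 ≤ y := by linarith [hy.1]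
    rw [abs_mul, abs_of_nonneg hy0]
    exact ⟨hy.2, by nlinarith [hy.1, abs_nonneg t]⟩
  have key := Convex.norm_image_sub_le_of_norm_hasDerivWithin_le (s := Set.Icc (1 / 2 : ℝ) (3 / 2))
    (f := fun y => t ^ p * (y ^ (q + 1) * iteratedDeriv q f (t * y)))
    (f' := fun y => t ^ p * ((q + 1) * y ^ q * iteratedDeriv q f (t * y) +
      y ^ (q + 1) * (iteratedDeriv (q + 1) f (t * y) * t))) (x := y) (y := 1)
    (C := (q + 1) * (3 / 2) ^ q * (2 ^ p * A) + (3 / 2) ^ (q + 1) * (2 ^ (p + 1) * B))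
    (fun z _ => ?_) (fun z hz => ?_) (convex_Icc _ _) ?_ (by norm_num)
  · have hy0 : 0 ≤ y := by linarith [abs_le.1 hy]
    rw [abs_sub_comm y]
    simp only [one_pow, mul_one, one_mul, ← mul_sub, norm_mul, norm_pow, Real.norm_eq_abs] at key
    rwa [abs_of_nonneg hy0, ← mul_assoc, ← pow_succ']
  · have h := (((hasDerivAt_pow (q + 1) z).mul ((f.hasDerivAt_iteratedDeriv q (t * z)).comp z
      ((hasDerivAt_id z).const_mul t))).const_mul (t ^ p)).hasDerivWithinAt
      (s := Set.Icc (1 / 2 : ℝ) (3 / 2))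
    convert! h using 1
    simp
  · obtain ⟨hz1, hz2⟩ := hs hz
    have hpow (m : ℕ) : |t| ^ m ≤ 2 ^ m * |t * z| ^ m := by
      rw [← mul_pow]
      gcongr
    calc _ ≤ |t| ^ p * ((q + 1) * |z| ^ q * |iteratedDeriv q f (t * z)| +
          |z| ^ (q + 1) * (|iteratedDeriv (q + 1) f (t * z)| * |t|)) := by
          rw [norm_mul, norm_pow, Real.norm_eq_abs, Real.norm_eq_abs]
          gcongr
          refine (abs_add_le _ _).trans_eq ?_
          simp only [abs_mul, abs_pow]
          rw [abs_of_nonneg (by positivity : (0 : ℝ) ≤ q + 1)]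
      _ = (q + 1) * |z| ^ q * (|t| ^ p * |iteratedDeriv q f (t * z)|) +
          |z| ^ (q + 1) * (|t| ^ (p + 1) * |iteratedDeriv (q + 1) f (t * z)|) := by ring
      _ ≤ (q + 1) * (3 / 2) ^ q * (2 ^ p * |t * z| ^ p * |iteratedDeriv q f (t * z)|) +
          (3 / 2) ^ (q + 1) *
            (2 ^ (p + 1) * |t * z| ^ (p + 1) * |iteratedDeriv (q + 1) f (t * z)|) := by
          gcongr
          exacts [hpow p, hpow (p + 1)]
      _ ≤ _ := by
          simp only [mul_assoc] at *
          gcongr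
          exacts [hfA _, hfB _]
  · constructor <;> linarith [abs_le.1 hy]

/-- Pointwise comparison of a Schwartz function with its dilations; away from dilation factor `1`
the decay in `t` is traded for powers of `|y - 1|`. -/
lemma exists_abs_sub_dilation_le (f : 𝓢(ℝ, ℝ)) (p q M : ℕ) (hM : q + 1 ≤ M) :
    ∃ C > 0, ∀ a t y : ℝ, |t| ≤ a →
      |t| ^ p * |iteratedDeriv q f t - |y| * (y ^ q * iteratedDeriv q f (t * y))| ≤
        C * (|y - 1| + a ^ p * |y - 1| ^ M) := by
  obtain ⟨C, hC, hnear⟩ := f.exists_abs_sub_dilation_le_of_abs_sub_one_le p q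
  obtain ⟨D, hD, hf⟩ := f.exists_abs_iteratedDeriv_le q
  refine ⟨C + D * (2 ^ M + 3 ^ M), by positivity, fun a t y ha => ?_⟩
  have ha0 : 0 ≤ a := (abs_nonneg t).trans ha
  set w := |y - 1| with hw
  have hw0 : 0 ≤ w := abs_nonneg _
  rcases le_or_gt w (1 / 2) with h | h
  · refine (hnear t y h).trans ?_
    gcongr
    · exact le_add_of_nonneg_right (by positivity)
    · exact le_add_of_nonneg_right (by positivity)
  · have hy : |y| ≤ 3 * w := by
      have := abs_add_le (y - 1) 1
      rw [sub_add_cancel, abs_one] at this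
      linarith
    have h2 : 1 ≤ (2 * w) ^ M := one_le_pow₀ (by linarith)
    have h3 : |y| ^ (q + 1) ≤ (3 * w) ^ M :=
      (pow_le_pow_left₀ (abs_nonneg y) hy _).trans (pow_le_pow_right₀ (by linarith) hM)
    calc _ ≤ a ^ p * (|iteratedDeriv q f t| + |y| ^ (q + 1) * |iteratedDeriv q f (t * y)|) := by
          gcongr
          refine (abs_sub _ _).trans_eq ?_
          simp only [abs_mul, abs_pow, abs_abs]
          ring
      _ ≤ a ^ p * ((2 * w) ^ M * D + (3 * w) ^ M * D) := by
          gcongr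
          · exact (hf t).trans (le_mul_of_one_le_left hD.le h2)
          · exact hf _
      _ = D * (2 ^ M + 3 ^ M) * (a ^ p * w ^ M) := by ring
      _ ≤ _ := by
          gcongr
          · exact le_add_of_nonneg_left hC.le
          · exact le_add_of_nonneg_left hw0

end SchwartzMap

/-- The density of `N₁/(1 + n^{-1/2}N₂)` (for independent standard normals) is
`O(n^{-1/2})`-close to the standard normal density in all Schwartz seminorms, for `|t| ≤ n`. -/
theorem gaussian_quotient_close (p q : ℕ) :
    ∃ C > (0 : ℝ), ∃ N : ℕ, ∀ n : ℕ, N ≤ n →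
      ∀ t : ℝ, |t| ≤ n →
        (let ρ : ℝ → ℝ := fun u => (1 / Real.sqrt (2 * π)) * Real.exp (-u ^ 2 / 2);
        let h : ℝ → ℝ := fun u =>
          ∫ y : ℝ, |y| * ρ (u * y) * (Real.sqrt n * ρ (Real.sqrt n * (y - 1)));
        |t ^ p * iteratedDeriv q (fun u => ρ u - h u) t| ≤ C / Real.sqrt n) := by
  obtain ⟨C, hC, hpt⟩ := stdGaussianDensity.exists_abs_sub_dilation_le p q (2 * p + (q + 2))
    (by omega)
  have hmom (k : ℕ) : Integrable (fun x : ℝ => |x| ^ k) (gaussianReal 0 1) := by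
    simpa using integrable_abs_affine_pow_gaussianReal 0 1 k
  have hmom1 : Integrable (fun x : ℝ => |x|) (gaussianReal 0 1) := by simpa using hmom 1
  set K := ∫ x : ℝ, (|x| + |x| ^ (2 * p + (q + 2))) ∂(gaussianReal 0 1) with hK
  have hK0 : 0 ≤ K := integral_nonneg fun x => by positivity
  refine ⟨C * K + 1, by positivity, 1, fun n hn t ht => ?_⟩
  intro ρ h
  have hn1 : (1 : ℝ) ≤ n := by exact_mod_cast hn
  have hc : 0 < √(n : ℝ) := Real.sqrt_pos.2 (by linarith)
  set s := (√(n : ℝ))⁻¹ with hs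
  have hs0 : 0 < s := inv_pos.2 hc
  have hs1 : s ≤ 1 := inv_le_one_of_one_le₀ (Real.one_le_sqrt.2 hn1)
  have hns : (n : ℝ) * s ^ 2 = 1 := by
    rw [hs, inv_pow, Real.sq_sqrt (by linarith), mul_inv_cancel₀ (by linarith)]
  have hh : (fun u => ρ u - h u) = fun u => stdGaussianDensity u -
      ∫ x, |1 + s * x| * stdGaussianDensity (u * (1 + s * x)) ∂(gaussianReal 0 1) := by
    ext u
    exact congrArg (ρ u - ·) (integral_mul_rescaled_stdGaussianDensity
      (fun y => |y| * stdGaussianDensity (u * y)) hc)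
  have hY : Measurable fun x : ℝ => 1 + s * x := by fun_prop
  have hYint := integrable_abs_affine_pow_gaussianReal 1 s
  have hdiff := stdGaussianDensity.integrable_abs_mul_pow_mul_iteratedDeriv hY hYint q t
  rw [hh, stdGaussianDensity.iteratedDeriv_integral_abs_mul_dilation hY hYint q]
  have hconst : iteratedDeriv q stdGaussianDensity t =
      ∫ _, iteratedDeriv q stdGaussianDensity t ∂(gaussianReal 0 1) := by simp
  beta_reduce
  rw [hconst, ← integral_sub (integrable_const _) hdiff, ← integral_const_mul]
  have hbound (x : ℝ) : ‖t ^ p * (iteratedDeriv q stdGaussianDensity t - |1 + s * x| *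
      ((1 + s * x) ^ q * iteratedDeriv q stdGaussianDensity (t * (1 + s * x))))‖ ≤
      C * s * (|x| + |x| ^ (2 * p + (q + 2))) := by
    have hsM : (n : ℝ) ^ p * s ^ (2 * p + (q + 2)) ≤ s := by
      rw [pow_add, pow_mul, ← mul_assoc, ← mul_pow, hns, one_pow, one_mul]
      exact pow_le_of_le_one hs0.le hs1 (by omega)
    rw [norm_mul, norm_pow, Real.norm_eq_abs, Real.norm_eq_abs]
    refine (hpt n t (1 + s * x) ht).trans ?_
    rw [add_sub_cancel_left, abs_mul, abs_of_pos hs0, mul_pow, ← mul_assoc, mul_assoc C, mul_add s]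
    gcongr
  refine (norm_integral_le_of_norm_le ((hmom1.add (hmom _)).const_mul (C * s))
    (ae_of_all _ hbound)).trans ?_
  calc _ = C * K * s := by
        rw [integral_const_mul, hK]
        simp only [Pi.add_apply]
        ring
    _ ≤ (C * K + 1) / √(n : ℝ) := by
        rw [div_eq_mul_inv]
        gcongr
        linarith
end

section
/- Let n ≥ 2 and let P_1, …, P_n be independent Exp(1)-distributed random variables. Then the random vector (P_1, …, P_n) / (∑_{k=1}^n P_k) is distributed according to Unif Δ_{n−1}, the normalized (n−1)-dimensional Hausdorff measure on the standard simplex Δ_{n−1} = { s ∈ ℝ^n : s_k ≥ 0 for all k, ∑_{k=1}^n s_k = 1 }. -/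
open Real Finset MeasureTheory ProbabilityTheory

open scoped ENNReal NNReal

/-- The lower Lebesgue integral of a product of functions of the separate coordinates. -/
theorem lintegral_pi_prod_eq_prod_lintegral {n : ℕ} (μ : Fin n → Measure ℝ)
    [∀ i, SigmaFinite (μ i)] (g : Fin n → ℝ → ℝ≥0∞) (hg : ∀ i, Measurable (g i)) :
    ∫⁻ x, ∏ i, g i (x i) ∂(Measure.pi μ) = ∏ i, ∫⁻ t, g i t ∂(μ i) := by
  induction n with
  | zero => simp
  | succ n ih =>
    rw [← (measurePreserving_piFinSuccAbove μ 0).symm.lintegral_comp_emb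
      (MeasurableEquiv.measurableEmbedding _)]
    simp only [MeasurableEquiv.piFinSuccAbove_symm_apply, Fin.insertNthEquiv,
      Fin.prod_univ_succ, Equiv.coe_fn_mk, Fin.insertNth_zero, Fin.cons_zero, Fin.cons_succ,
      Fin.zero_succAbove]
    have hm : Measurable fun y : Fin n → ℝ => ∏ i, g i.succ (y i) :=
      Finset.measurable_prod _ fun i _ => (hg i.succ).comp (measurable_pi_apply i)
    rw [← ih (fun i => μ i.succ) _ fun i => hg i.succ]
    exact lintegral_prod_mul (hg 0).aemeasurable hm.aemeasurable

/-- A finite product of measures with densities has the product density. -/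
theorem pi_withDensity_eq {n : ℕ} (μ : Fin n → Measure ℝ) [∀ i, SigmaFinite (μ i)]
    (f : Fin n → ℝ → ℝ≥0∞) (hf : ∀ i, Measurable (f i))
    [∀ i, SigmaFinite ((μ i).withDensity (f i))] :
    Measure.pi (fun i => (μ i).withDensity (f i)) =
      (Measure.pi μ).withDensity fun x => ∏ i, f i (x i) := by
  refine Measure.pi_eq (μ := fun i => (μ i).withDensity (f i)) fun s hs => ?_
  rw [withDensity_apply _ (MeasurableSet.univ_pi hs),
    ← lintegral_indicator (MeasurableSet.univ_pi hs)]
  have : ∀ x : Fin n → ℝ, (Set.univ.pi s).indicator (fun x => ∏ i, f i (x i)) x =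
      ∏ i, (s i).indicator (f i) (x i) := by
    intro x
    by_cases hx : x ∈ Set.univ.pi s
    · rw [Set.indicator_of_mem hx]
      exact Finset.prod_congr rfl fun i _ => (Set.indicator_of_mem (hx i trivial) _).symm
    · rw [Set.indicator_of_notMem hx]
      simp only [Set.mem_pi, Set.mem_univ, true_imp_iff, not_forall] at hx
      obtain ⟨i, hi⟩ := hx
      exact (Finset.prod_eq_zero (Finset.mem_univ i) (Set.indicator_of_notMem hi _)).symm
  simp_rw [this]
  rw [lintegral_pi_prod_eq_prod_lintegral μ _ fun i => (hf i).indicator (hs i)]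
  refine Finset.prod_congr rfl fun i _ => ?_
  rw [lintegral_indicator (hs i), withDensity_apply _ (hs i)]

/-- The standard simplex in Euclidean space. -/
def euclideanSimplex (n : ℕ) : Set (EuclideanSpace ℝ (Fin n)) :=
  {s | (∀ k, 0 ≤ s k) ∧ (∑ k, s k) = 1}

theorem isClosed_euclideanSimplex (n : ℕ) : IsClosed (euclideanSimplex n) := by
  have h : euclideanSimplex n = (⋂ k, {s | 0 ≤ s k}) ∩ {s | (∑ k, s k) = 1} := by
    ext s
    simp [euclideanSimplex]
  rw [h]
  exact (isClosed_iInter fun k => isClosed_le continuous_const (by fun_prop)).inter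
    (isClosed_eq (by fun_prop) continuous_const)

/-- The linear part of the parametrization of the hyperplane of coordinate sum one. -/
noncomputable def hyperplaneParamLinear (m : ℕ) :
    (Fin m → ℝ) →L[ℝ] EuclideanSpace ℝ (Fin (m + 1)) :=
  LinearMap.toContinuousLinearMap
    ((WithLp.linearEquiv 2 ℝ (Fin (m + 1) → ℝ)).symm.toLinearMap ∘ₗ
      LinearMap.pi (Fin.cons (-∑ i, LinearMap.proj i) fun i => LinearMap.proj i))

/-- The parametrization of the hyperplane of coordinate sum one by its last coordinates. -/
noncomputable def hyperplaneParam (m : ℕ) (t : Fin m → ℝ) : EuclideanSpace ℝ (Fin (m + 1)) :=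
  WithLp.toLp 2 (Fin.cons (1 - ∑ i, t i) t)

theorem hyperplaneParam_zero_apply {m : ℕ} (t : Fin m → ℝ) :
    hyperplaneParam m t 0 = 1 - ∑ i, t i := rfl

theorem hyperplaneParam_succ_apply {m : ℕ} (t : Fin m → ℝ) (i : Fin m) :
    hyperplaneParam m t i.succ = t i := rfl

theorem hyperplaneParam_add {m : ℕ} (t u : Fin m → ℝ) :
    hyperplaneParam m (t + u) = hyperplaneParamLinear m t + hyperplaneParam m u := by
  ext k
  refine Fin.cases ?_ (fun i => ?_) k
  · simp [hyperplaneParam, hyperplaneParamLinear, Finset.sum_add_distrib]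
    ring
  · simp [hyperplaneParam, hyperplaneParamLinear]

theorem lipschitzWith_hyperplaneParam (m : ℕ) :
    LipschitzWith ‖hyperplaneParamLinear m‖₊ (hyperplaneParam m) := by
  refine LipschitzWith.of_dist_le_mul fun t u => ?_
  have h (v) : hyperplaneParam m v = hyperplaneParamLinear m v + hyperplaneParam m 0 := by
    rw [← hyperplaneParam_add, add_zero]
  rw [h t, h u, dist_add_right]
  exact (hyperplaneParamLinear m).lipschitz.dist_le_mul t u

theorem antilipschitzWith_hyperplaneParam (m : ℕ) :
    AntilipschitzWith 1 (hyperplaneParam m) := by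
  refine AntilipschitzWith.of_le_mul_dist fun t u => ?_
  rw [NNReal.coe_one, one_mul]
  refine (dist_pi_le_iff dist_nonneg).2 fun i => ?_
  rw [dist_eq_norm (hyperplaneParam m t), Real.dist_eq]
  exact PiLp.norm_apply_le (hyperplaneParam m t - hyperplaneParam m u) i.succ

theorem measurableEmbedding_hyperplaneParam (m : ℕ) :
    MeasurableEmbedding (hyperplaneParam m) :=
  ((antilipschitzWith_hyperplaneParam m).isClosedEmbedding
    (lipschitzWith_hyperplaneParam m).uniformContinuous).measurableEmbedding

theorem euclideanSimplex_subset_range (m : ℕ) :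
    euclideanSimplex (m + 1) ⊆ Set.range (hyperplaneParam m) := by
  rintro s ⟨-, hs⟩
  refine ⟨fun i => s i.succ, ?_⟩
  rw [Fin.sum_univ_succ] at hs
  ext k
  refine Fin.cases ?_ (fun i => ?_) k
  · rw [hyperplaneParam_zero_apply]
    linarith
  · rfl

/-- Pulling the Hausdorff measure back along the parametrization of the hyperplane gives a positive
finite multiple of Lebesgue measure. -/
theorem exists_comap_hyperplaneParam_hausdorffMeasure (m : ℕ) :
    ∃ c : ℝ≥0∞, c ≠ 0 ∧ c ≠ ∞ ∧
      (μH[(m : ℝ)] : Measure (EuclideanSpace ℝ (Fin (m + 1)))).comap (hyperplaneParam m) =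
        c • (volume : Measure (Fin m → ℝ)) := by
  set A := hyperplaneParam m
  have hA := measurableEmbedding_hyperplaneParam m
  set ν := (μH[(m : ℝ)] : Measure (EuclideanSpace ℝ (Fin (m + 1)))).comap A
  have hvol : (μH[(m : ℝ)] : Measure (Fin m → ℝ)) = volume := by
    simpa using hausdorffMeasure_pi_real (ι := Fin m)
  have happ (s : Set (Fin m → ℝ)) : ν s = μH[(m : ℝ)] (A '' s) := hA.comap_apply _ s
  have hle (s : Set (Fin m → ℝ)) :
      ν s ≤ (‖hyperplaneParamLinear m‖₊ : ℝ≥0∞) ^ (m : ℝ) * volume s := by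
    rw [happ, ← hvol]
    exact (lipschitzWith_hyperplaneParam m).hausdorffMeasure_image_le m.cast_nonneg s
  have hge (s : Set (Fin m → ℝ)) : volume s ≤ ν s := by
    rw [happ, ← hvol]
    simpa using (antilipschitzWith_hyperplaneParam m).le_hausdorffMeasure_image m.cast_nonneg s
  have hinv : ν.IsAddLeftInvariant := by
    refine ⟨fun t => ?_⟩
    ext s hs
    rw [Measure.map_apply (measurable_const_add t) hs, happ, happ,
      ← hausdorffMeasure_vadd (hyperplaneParamLinear m t) (Or.inl m.cast_nonneg) (A '' (_ ⁻¹' s))]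
    congr 1
    ext y
    constructor
    · rintro ⟨_, ⟨u, hu, rfl⟩, rfl⟩
      exact ⟨t + u, hu, hyperplaneParam_add t u⟩
    · rintro ⟨u, hu, rfl⟩
      refine ⟨_, ⟨-t + u, by simpa using hu, rfl⟩, ?_⟩
      have := hyperplaneParam_add t (-t + u)
      rw [add_neg_cancel_left] at this
      exact this.symm
  have hfin : IsFiniteMeasureOnCompacts ν := ⟨fun K hK => (hle K).trans_lt
    (ENNReal.mul_lt_top (ENNReal.rpow_lt_top_of_nonneg m.cast_nonneg ENNReal.coe_ne_top)
      hK.measure_lt_top)⟩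
  have heq := Measure.isAddLeftInvariant_eq_smul ν (volume : Measure (Fin m → ℝ))
  refine ⟨(ν.addHaarScalarFactor (volume : Measure (Fin m → ℝ)) : ℝ≥0∞), ?_,
    ENNReal.coe_ne_top, heq⟩
  intro h0
  have h1 := hge Set.univ
  rw [heq, ENNReal.coe_eq_zero.1 h0, zero_smul] at h1
  exact Measure.measure_univ_ne_zero.2 (NeZero.ne _) (nonpos_iff_eq_zero.1 h1)

/-- Hausdorff measure on the simplex is a positive finite multiple of the image of Lebesgue measure
under the parametrization. -/
theorem exists_restrict_hausdorffMeasure_euclideanSimplex (m : ℕ) :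
    ∃ c : ℝ≥0∞, c ≠ 0 ∧ c ≠ ∞ ∧
      (μH[(m : ℝ)] : Measure (EuclideanSpace ℝ (Fin (m + 1)))).restrict (euclideanSimplex (m + 1)) =
        c • (Measure.map (hyperplaneParam m) volume).restrict (euclideanSimplex (m + 1)) := by
  obtain ⟨c, h0, ht, h⟩ := exists_comap_hyperplaneParam_hausdorffMeasure m
  refine ⟨c, h0, ht, ?_⟩
  rw [← Measure.restrict_smul, ← Measure.map_smul, ← h,
    (measurableEmbedding_hyperplaneParam m).map_comap,
    Measure.restrict_restrict (isClosed_euclideanSimplex _).measurableSet,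
    Set.inter_eq_left.2 (euclideanSimplex_subset_range m)]

/-- The quotient of a vector by its coordinate sum. -/
noncomputable def sumNormalize (n : ℕ) (ω : Fin n → ℝ) : EuclideanSpace ℝ (Fin n) :=
  (WithLp.equiv 2 (Fin n → ℝ)).symm (fun k => ω k / ∑ j, ω j)

theorem measurable_sumNormalize (n : ℕ) : Measurable (sumNormalize n) := by
  have h : Measurable fun ω : Fin n → ℝ => fun k => ω k / ∑ j, ω j := by fun_prop
  exact (WithLp.measurable_toLp 2 _).comp h

theorem prod_exponentialPDF_one {n : ℕ} (x : Fin n → ℝ) :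
    ∏ i, exponentialPDF 1 (x i) =
      {x : Fin n → ℝ | ∀ i, 0 ≤ x i}.indicator (fun x => ENNReal.ofReal (exp (-∑ i, x i))) x := by
  by_cases hx : ∀ i, 0 ≤ x i
  · rw [Set.indicator_of_mem (Set.mem_ofPred.2 hx), ← Finset.sum_neg_distrib, Real.exp_sum,
      ENNReal.ofReal_prod_of_nonneg fun i _ => (exp_pos _).le]
    refine Finset.prod_congr rfl fun i _ => ?_
    rw [exponentialPDF_of_nonneg (hx i), one_mul, one_mul]
  · rw [Set.indicator_of_notMem (by simpa using hx)]
    push Not at hx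
    obtain ⟨i, hi⟩ := hx
    exact Finset.prod_eq_zero (Finset.mem_univ i) (exponentialPDF_of_neg hi)

theorem measurable_exponentialPDF_one : Measurable (exponentialPDF 1) :=
  (measurable_exponentialPDFReal 1).ennreal_ofReal

theorem pi_expMeasure_one (n : ℕ) :
    (Measure.pi fun _ : Fin n => expMeasure 1) =
      volume.withDensity fun x => ∏ i, exponentialPDF 1 (x i) := by
  have : IsProbabilityMeasure ((volume : Measure ℝ).withDensity (exponentialPDF 1)) :=
    isProbabilityMeasure_expMeasure one_pos
  exact pi_withDensity_eq (fun _ => volume) (fun _ => exponentialPDF 1)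
    fun _ => measurable_exponentialPDF_one

/-- On the slice of coordinate sum `s`, the exponential density is constant on its support, which
is a dilated simplex. -/
theorem prod_exponentialPDF_mul_comp_sumNormalize {m : ℕ}
    (g : EuclideanSpace ℝ (Fin (m + 1)) → ℝ≥0∞) {s : ℝ} (hs : s ≠ 0) (x : Fin m → ℝ) :
    (∏ i, exponentialPDF 1 ((Fin.cons (s - ∑ i, x i) x : Fin (m + 1) → ℝ) i)) *
        g (sumNormalize (m + 1) (Fin.cons (s - ∑ i, x i) x)) =
      (Set.Ioi (0 : ℝ)).indicator (fun s => ENNReal.ofReal (exp (-s))) s *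
        (euclideanSimplex (m + 1)).indicator g (hyperplaneParam m (s⁻¹ • x)) := by
  set y : Fin (m + 1) → ℝ := Fin.cons (s - ∑ i, x i) x with hy
  have hsum : ∑ i, y i = s := by simp [hy, Fin.sum_univ_succ]
  have hN : sumNormalize (m + 1) y = hyperplaneParam m (s⁻¹ • x) := by
    ext k
    change y k / ∑ j, y j = _
    rw [hsum]
    refine Fin.cases ?_ (fun i => ?_) k
    · rw [hyperplaneParam_zero_apply]
      simp only [hy, Fin.cons_zero, Pi.smul_apply, smul_eq_mul, ← Finset.mul_sum]
      field_simp
    · rw [hyperplaneParam_succ_apply]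
      simp only [hy, Fin.cons_succ, Pi.smul_apply, smul_eq_mul]
      field_simp
  rw [prod_exponentialPDF_one, ← hN]
  have hmem (hpos : 0 < s) : sumNormalize (m + 1) y ∈ euclideanSimplex (m + 1) ↔ ∀ i, 0 ≤ y i := by
    have hk (k) : sumNormalize (m + 1) y k = y k / s := by rw [← hsum]; rfl
    simp only [euclideanSimplex, Set.mem_ofPred_eq, hk, ← Finset.sum_div, hsum, div_self hs,
      and_true, le_div_iff₀ hpos, zero_mul]
  rcases hs.lt_or_gt with hneg | hpos
  · rw [Set.indicator_of_notMem, Set.indicator_of_notMem (by simpa using hneg.le), zero_mul,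
      zero_mul]
    intro h
    exact hneg.not_ge (hsum ▸ Finset.sum_nonneg fun i _ => h i)
  · rw [Set.indicator_of_mem (s := Set.Ioi (0 : ℝ)) hpos]
    by_cases h : ∀ i, 0 ≤ y i
    · rw [Set.indicator_of_mem (Set.mem_ofPred.2 h), Set.indicator_of_mem ((hmem hpos).2 h), hsum]
    · rw [Set.indicator_of_notMem (by simpa using h), Set.indicator_of_notMem (mt (hmem hpos).1 h),
        zero_mul, mul_zero]

/-- Integration over `ℝ^(m+1)` by slicing along the level sets of the coordinate sum. -/
theorem lintegral_fin_succ_eq_lintegral_sum_slices {m : ℕ} {F : (Fin (m + 1) → ℝ) → ℝ≥0∞}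
    (hF : Measurable F) :
    ∫⁻ y, F y = ∫⁻ s : ℝ, ∫⁻ x : Fin m → ℝ, F (Fin.cons (s - ∑ i, x i) x) := by
  have hcons : Measurable fun p : ℝ × (Fin m → ℝ) => (Fin.cons p.1 p.2 : Fin (m + 1) → ℝ) := by
    refine measurable_pi_lambda _ fun k => ?_
    refine Fin.cases ?_ (fun i => ?_) k
    · exact measurable_fst
    · exact (measurable_pi_apply i).comp measurable_snd
  have hFc : Measurable fun p : ℝ × (Fin m → ℝ) => F (Fin.cons p.1 p.2) := hF.comp hcons
  have hsh : Measurable fun p : (Fin m → ℝ) × ℝ => (p.2 - ∑ i, p.1 i, p.1) := by fun_prop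
  calc
    ∫⁻ y, F y = ∫⁻ p : ℝ × (Fin m → ℝ), F (Fin.cons p.1 p.2) := by
      rw [← (volume_preserving_piFinSuccAbove (fun _ : Fin (m + 1) => ℝ) 0).symm.lintegral_comp_emb
        (MeasurableEquiv.measurableEmbedding _)]
      simp only [MeasurableEquiv.piFinSuccAbove_symm_apply, Fin.insertNthEquiv, Equiv.coe_fn_mk,
        Fin.insertNth_zero]
      rfl
    _ = ∫⁻ x : Fin m → ℝ, ∫⁻ u : ℝ, F (Fin.cons u x) := by
      rw [Measure.volume_eq_prod, lintegral_prod_symm _ hFc.aemeasurable]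
    _ = ∫⁻ x : Fin m → ℝ, ∫⁻ s : ℝ, F (Fin.cons (s - ∑ i, x i) x) := by
      refine lintegral_congr fun x => ?_
      exact (lintegral_sub_right_eq_self (fun u : ℝ => F (Fin.cons u x)) (∑ i, x i)).symm
    _ = _ := lintegral_lintegral_swap (hFc.comp hsh).aemeasurable

/-- Dilation of the variable in a lower Lebesgue integral on `ℝ^m`. -/
theorem lintegral_comp_inv_smul {m : ℕ} {h : (Fin m → ℝ) → ℝ≥0∞} (hh : Measurable h) {s : ℝ}
    (hs : s ≠ 0) : ∫⁻ x, h (s⁻¹ • x) = ENNReal.ofReal |s ^ m| * ∫⁻ x, h x := by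
  rw [← lintegral_map hh (measurable_const_smul s⁻¹),
    Measure.map_addHaar_smul volume (inv_ne_zero hs), lintegral_smul_measure]
  simp

/-- The law of the normalized exponential vector is a multiple of the image of Lebesgue measure
on the simplex. -/
theorem exists_map_sumNormalize_pi_expMeasure (m : ℕ) :
    ∃ K : ℝ≥0∞, Measure.map (sumNormalize (m + 1)) (Measure.pi fun _ => expMeasure 1) =
      K • (Measure.map (hyperplaneParam m) volume).restrict (euclideanSimplex (m + 1)) := by
  have hA := (measurableEmbedding_hyperplaneParam m).measurable
  have hΔ := (isClosed_euclideanSimplex (m + 1)).measurableSet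
  set w : ℝ → ℝ≥0∞ := (Set.Ioi (0 : ℝ)).indicator fun s => ENNReal.ofReal (exp (-s))
  have hwm : Measurable w := Measurable.indicator (by fun_prop) measurableSet_Ioi
  refine ⟨∫⁻ s, w s * ENNReal.ofReal |s ^ m|, Measure.ext_of_lintegral _ fun g hg => ?_⟩
  have hD : Measurable fun x : Fin (m + 1) → ℝ => ∏ i, exponentialPDF 1 (x i) :=
    Finset.measurable_prod _ fun i _ => measurable_exponentialPDF_one.comp (measurable_pi_apply i)
  have hgN : Measurable fun x => g (sumNormalize (m + 1) x) := hg.comp (measurable_sumNormalize _)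
  have hgA : Measurable fun x => (euclideanSimplex (m + 1)).indicator g (hyperplaneParam m x) :=
    (hg.indicator hΔ).comp hA
  rw [lintegral_map hg (measurable_sumNormalize _), pi_expMeasure_one,
    lintegral_withDensity_eq_lintegral_mul _ hD hgN,
    lintegral_fin_succ_eq_lintegral_sum_slices (hD.mul hgN), lintegral_smul_measure,
    ← lintegral_indicator hΔ, lintegral_map (hg.indicator hΔ) hA, smul_eq_mul,
    ← lintegral_mul_const _ (by fun_prop)]
  refine lintegral_congr_ae ?_
  filter_upwards [Measure.ae_ne volume (0 : ℝ)] with s hs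
  simp only [Pi.mul_apply]
  simp_rw [prod_exponentialPDF_mul_comp_sumNormalize g hs]
  have hscale : Measurable fun x : Fin m → ℝ =>
      (euclideanSimplex (m + 1)).indicator g (hyperplaneParam m (s⁻¹ • x)) :=
    hgA.comp (measurable_const_smul s⁻¹)
  rw [lintegral_const_mul _ hscale, lintegral_comp_inv_smul hgA hs, mul_assoc]

/-- If `P₁, …, P_n` are i.i.d. `Exp(1)` random variables, then the random vector
`(P₁, …, P_n)/∑ P_k` is uniformly distributed on the standard simplex `Δ_{n-1}`,
i.e. distributed according to the normalized `(n-1)`-dimensional Hausdorff measure on it. -/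
theorem exponential_quotient_uniform_simplex (n : ℕ) (hn : 2 ≤ n) :
    (let Δ : Set (EuclideanSpace ℝ (Fin n)) :=
      {s | (∀ k, 0 ≤ s k) ∧ (∑ k, s k) = 1};
    Measure.map
        (fun ω : Fin n → ℝ =>
          (WithLp.equiv 2 (Fin n → ℝ)).symm (fun k => ω k / ∑ j, ω j))
        (Measure.pi fun _ : Fin n => expMeasure 1) =
      (μH[(n : ℝ) - 1] Δ)⁻¹ • (μH[(n : ℝ) - 1]).restrict Δ) := by
  obtain ⟨m, rfl⟩ : ∃ m, n = m + 1 := ⟨n - 1, by omega⟩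
  have hcast : ((m + 1 : ℕ) : ℝ) - 1 = m := by push_cast; ring
  rw [hcast]
  change Measure.map (sumNormalize (m + 1)) _ = (μH[(m : ℝ)] (euclideanSimplex (m + 1)))⁻¹ •
    (μH[(m : ℝ)]).restrict (euclideanSimplex (m + 1))
  obtain ⟨c, hc0, hct, hc⟩ := exists_restrict_hausdorffMeasure_euclideanSimplex m
  obtain ⟨K, hK⟩ := exists_map_sumNormalize_pi_expMeasure m
  have : IsProbabilityMeasure (expMeasure 1) := isProbabilityMeasure_expMeasure one_pos
  have hprob : Measure.map (sumNormalize (m + 1))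
      (Measure.pi fun _ : Fin (m + 1) => expMeasure 1) Set.univ = 1 := by
    rw [Measure.map_apply (measurable_sumNormalize _) MeasurableSet.univ, Set.preimage_univ,
      measure_univ]
  have heq : Measure.map (sumNormalize (m + 1)) (Measure.pi fun _ : Fin (m + 1) => expMeasure 1) =
      (K * c⁻¹) • (μH[(m : ℝ)]).restrict (euclideanSimplex (m + 1)) := by
    rw [hc, smul_smul, mul_assoc, ENNReal.inv_mul_cancel hc0 hct, mul_one, hK]
  rw [heq, Measure.smul_apply, Measure.restrict_apply_univ, smul_eq_mul] at hprob
  rw [heq, ENNReal.eq_inv_of_mul_eq_one_left hprob]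
end

section
/- Let n ≥ 3 and let x_1 < x_2 < … < x_n be real numbers, let B(t) = ∑_{k=1}^n (x_k − t)_+^{n−2} / ∏_{j≠k}(x_k − x_j), and let W(x) = ∏_{k=1}^n (x − x_k). Then for every real ξ ≠ 0, the Fourier transform of the function t ↦ B(t/n) satisfies ∫_ℝ B(t/n) e^{−i t ξ} dt = ( (n−2)! · i^{n−1} / (n^{n−2} ξ^{n−1}) ) ∑_{k=1}^n e^{−i n ξ x_k} / W'(x_k). -/
open Real Finset MeasureTheory

/-- Divided differences over the distinct nodes `x k` annihilate polynomials whose degree is less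
than the number of nodes minus one. -/
theorem Polynomial.sum_eval_div_prod_sub_eq_zero {ι K : Type*} [Fintype ι] [DecidableEq ι] [Field K]
    {x : ι → K} (hx : Function.Injective x) (P : Polynomial K)
    (hP : P.natDegree + 1 < Fintype.card ι) :
    ∑ k, P.eval (x k) / ∏ j ∈ univ.erase k, (x k - x j) = 0 := by
  rw [← Finset.card_univ] at hP
  have hdeg : P.degree < #(univ : Finset ι) :=
    P.degree_le_natDegree.trans_lt (by exact_mod_cast (Nat.lt_succ_self _).trans hP)
  rw [← Lagrange.coeff_eq_sum hx.injOn hdeg]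
  exact Polynomial.coeff_eq_zero_of_natDegree_lt (by omega)

/-- The equation `Q' + c Q = X ^ m` has a polynomial solution of degree at most `m`. -/
theorem Polynomial.exists_derivative_add_C_mul_eq_X_pow {K : Type*} [Field K] {c : K} (hc : c ≠ 0)
    (m : ℕ) :
    ∃ Q : Polynomial K, Q.natDegree ≤ m ∧ Q.eval 0 = (-1) ^ m * m.factorial / c ^ (m + 1) ∧
      derivative Q + C c * Q = X ^ m := by
  induction m with
  | zero =>
    refine ⟨C c⁻¹, by simp, by simp, ?_⟩
    rw [derivative_C, zero_add, ← C_mul, mul_inv_cancel₀ hc, pow_zero, C_1]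
  | succ m ih =>
    obtain ⟨Q, hdeg, hQ, hder⟩ := ih
    refine ⟨C c⁻¹ * (X ^ (m + 1) - C (m + 1 : K) * Q), ?_, ?_, ?_⟩
    · refine (natDegree_C_mul_le _ _).trans ((natDegree_sub_le _ _).trans (max_le ?_ ?_))
      · exact natDegree_X_pow_le _
      · exact (natDegree_C_mul_le _ _).trans (hdeg.trans m.le_succ)
    · simp only [eval_mul, eval_C, eval_sub, eval_pow, eval_X, hQ, Nat.factorial_succ]
      push_cast
      field_simp
      ring
    · have hcc : (C c⁻¹ * C c : Polynomial K) = 1 := by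
        rw [← C_mul, inv_mul_cancel₀ hc, C_1]
      have hder' := congrArg (fun p => C c⁻¹ * (C (m + 1 : K) * p)) hder
      simp only [derivative_mul, derivative_C, derivative_sub, derivative_X_pow, zero_mul, zero_add,
        Nat.add_sub_cancel, Nat.cast_add, Nat.cast_one] at hder' ⊢
      linear_combination -hder' + X ^ (m + 1) * hcc

/-- Fourier integral of a truncated power over a bounded interval, in terms of a polynomial solution
of `Q' + c Q = X ^ m`. -/
theorem integral_posPart_pow_mul_cexp {c : ℂ} {m : ℕ} (hm : m ≠ 0) {Q : Polynomial ℂ}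
    (hQ : Q.derivative + Polynomial.C c * Q = Polynomial.X ^ m) {y L R : ℝ} (hL : L ≤ y)
    (hR : y ≤ R) :
    ∫ s in L..R, ((max (y - s) 0 : ℝ) : ℂ) ^ m * Complex.exp (-c * s) =
      Complex.exp (-c * L) * Q.eval ((y : ℂ) - L) - Complex.exp (-c * y) * Q.eval 0 := by
  have hcont : Continuous fun s : ℝ =>
      ((max (y - s) 0 : ℝ) : ℂ) ^ m * Complex.exp (-c * s) := by fun_prop
  rw [← intervalIntegral.integral_add_adjacent_intervals (hcont.intervalIntegrable L y)
    (hcont.intervalIntegrable y R)]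
  have hright : ∫ s in y..R, ((max (y - s) 0 : ℝ) : ℂ) ^ m * Complex.exp (-c * s) = 0 := by
    refine intervalIntegral.integral_zero_ae (Filter.Eventually.of_forall fun s hs => ?_)
    rw [Set.uIoc_of_le hR] at hs
    rw [max_eq_right (by linarith [hs.1])]
    simp [hm]
  have hderiv : ∀ s : ℝ, HasDerivAt
      (fun s : ℝ => -(Complex.exp (-c * s) * Q.eval ((y : ℂ) - s)))
      (((y : ℂ) - s) ^ m * Complex.exp (-c * s)) s := by
    intro s
    have hs : HasDerivAt (fun s : ℝ => (s : ℂ)) 1 s := Complex.ofRealCLM.hasDerivAt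
    have he := (hs.const_mul (-c)).cexp
    have hq := (Q.hasDerivAt ((y : ℂ) - s)).comp s (hs.const_sub (y : ℂ))
    have hev := congrArg (Polynomial.eval ((y : ℂ) - s)) hQ
    simp only [Polynomial.eval_add, Polynomial.eval_mul, Polynomial.eval_C, Polynomial.eval_pow,
      Polynomial.eval_X] at hev
    refine (he.mul hq).neg.congr_deriv ?_
    simp only [Function.comp_apply]
    linear_combination Complex.exp (-c * s) * hev
  have hleft : ∫ s in L..y, ((max (y - s) 0 : ℝ) : ℂ) ^ m * Complex.exp (-c * s) =
      ∫ s in L..y, ((y : ℂ) - s) ^ m * Complex.exp (-c * s) := by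
    refine intervalIntegral.integral_congr fun s hs => ?_
    rw [Set.uIcc_of_le hL] at hs
    rw [max_eq_left (by linarith [hs.2]), Complex.ofReal_sub]
  rw [hright, hleft, intervalIntegral.integral_eq_sub_of_hasDerivAt (fun s _ => hderiv s)
    (Continuous.intervalIntegrable (by fun_prop) _ _), sub_self]
  ring

/-- Fourier transform of the divided difference of truncated powers over distinct nodes. -/
theorem integral_sum_posPart_pow_div_mul_cexp {ι : Type*} [Fintype ι] [DecidableEq ι] {x : ι → ℝ}
    (hx : Function.Injective x) {m : ℕ} (hm : m ≠ 0) (hcard : m + 1 < Fintype.card ι) {c : ℂ}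
    (hc : c ≠ 0) :
    ∫ s : ℝ, (∑ k, ((max (x k - s) 0 : ℝ) : ℂ) ^ m /
        ∏ j ∈ univ.erase k, ((x k : ℂ) - x j)) * Complex.exp (-c * s) =
      (-1) ^ (m + 1) * m.factorial / c ^ (m + 1) *
        ∑ k, Complex.exp (-c * x k) / ∏ j ∈ univ.erase k, ((x k : ℂ) - x j) := by
  obtain ⟨Q, hdeg, hQ0, hQ⟩ := Polynomial.exists_derivative_add_C_mul_eq_X_pow hc m
  obtain ⟨L, hL⟩ := (Set.finite_range x).bddBelow
  obtain ⟨R, hR⟩ := (Set.finite_range x).bddAbove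
  replace hL k : L ≤ x k := hL ⟨k, rfl⟩
  replace hR k : x k ≤ R := hR ⟨k, rfl⟩
  obtain ⟨k₀⟩ : Nonempty ι := Fintype.card_pos_iff.mp (by omega)
  have hLR : L ≤ R := (hL k₀).trans (hR k₀)
  have hxC : Function.Injective fun k => (x k : ℂ) := Complex.ofReal_injective.comp hx
  have hsupp : ∀ s ∉ Set.Ioc L R, (∑ k, ((max (x k - s) 0 : ℝ) : ℂ) ^ m /
      ∏ j ∈ univ.erase k, ((x k : ℂ) - x j)) * Complex.exp (-c * s) = 0 := by
    intro s hs
    rw [mul_eq_zero]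
    left
    by_cases hsL : s ≤ L
    · have h := Polynomial.sum_eval_div_prod_sub_eq_zero hxC
        ((Polynomial.X - Polynomial.C (s : ℂ)) ^ m) (by
          rwa [Polynomial.natDegree_pow, Polynomial.natDegree_X_sub_C, mul_one])
      refine Eq.trans (sum_congr rfl fun k _ => ?_) h
      rw [max_eq_left (by linarith [hL k])]
      simp
    · have hsR : R < s := by
        by_contra h
        exact hs ⟨not_le.mp hsL, not_lt.mp h⟩
      refine sum_eq_zero fun k _ => ?_
      rw [max_eq_right (by linarith [hR k])]
      simp [hm]
  rw [← setIntegral_eq_integral_of_forall_compl_eq_zero hsupp,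
    ← intervalIntegral.integral_of_le hLR]
  have hterm : ∀ s : ℝ, (∑ k, ((max (x k - s) 0 : ℝ) : ℂ) ^ m /
      ∏ j ∈ univ.erase k, ((x k : ℂ) - x j)) * Complex.exp (-c * s) =
      ∑ k, (((max (x k - s) 0 : ℝ) : ℂ) ^ m * Complex.exp (-c * s)) /
        ∏ j ∈ univ.erase k, ((x k : ℂ) - x j) := by
    intro s
    rw [sum_mul]
    exact sum_congr rfl fun k _ => div_mul_eq_mul_div _ _ _
  simp_rw [hterm]
  rw [intervalIntegral.integral_finsetSum fun k _ =>
    Continuous.intervalIntegrable (by fun_prop) _ _]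
  simp_rw [intervalIntegral.integral_div, integral_posPart_pow_mul_cexp hm hQ (hL _) (hR _)]
  have hpoly := Polynomial.sum_eval_div_prod_sub_eq_zero hxC
    (Q.comp (Polynomial.X - Polynomial.C (L : ℂ))) (by
      rw [Polynomial.natDegree_comp, Polynomial.natDegree_X_sub_C]; omega)
  simp only [Polynomial.eval_comp, Polynomial.eval_sub, Polynomial.eval_X,
    Polynomial.eval_C] at hpoly
  simp_rw [sub_div, sum_sub_distrib, mul_div_assoc]
  rw [← mul_sum, hpoly, mul_zero, zero_sub, mul_sum, ← sum_neg_distrib, hQ0]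
  exact sum_congr rfl fun k _ => by ring

/-- Fourier transform of the rescaled B-spline `t ↦ B(t/n)`:
`∫ B(t/n) e^{-itξ} dt = ((n-2)! i^{n-1} / (n^{n-2} ξ^{n-1})) ∑_k e^{-inξx_k}/W'(x_k)`. -/
theorem fourier_bspline (n : ℕ) (hn : 3 ≤ n) (x : Fin n → ℝ) (hx : StrictMono x)
    (ξ : ℝ) (hξ : ξ ≠ 0) :
    (∫ t : ℝ,
        ((∑ k, (max (x k - t / n) 0) ^ (n - 2) /
            ∏ j ∈ univ.erase k, (x k - x j) : ℝ) : ℂ) *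
          Complex.exp (-Complex.I * t * ξ))
      = ((Nat.factorial (n - 2) : ℂ) * Complex.I ^ (n - 1) /
            ((n : ℂ) ^ (n - 2) * (ξ : ℂ) ^ (n - 1))) *
          ∑ k, Complex.exp (-Complex.I * n * ξ * x k) /
            ∏ j ∈ univ.erase k, ((x k : ℂ) - (x j : ℂ)) := by
  obtain ⟨m, hnm⟩ : ∃ m, n = m + 2 := ⟨n - 2, by omega⟩
  rw [show n - 2 = m by omega, show n - 1 = m + 1 by omega]
  have hN : (n : ℂ) ≠ 0 := by exact_mod_cast (by omega : n ≠ 0)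
  have hξC : (ξ : ℂ) ≠ 0 := by exact_mod_cast hξ
  have hc : Complex.I * n * ξ ≠ 0 := mul_ne_zero (mul_ne_zero Complex.I_ne_zero hN) hξC
  have hmain := integral_sum_posPart_pow_div_mul_cexp hx.injective (m := m) (by omega)
    (by rw [Fintype.card_fin]; omega) hc
  have hscale := Measure.integral_comp_div (fun s : ℝ => (∑ k, ((max (x k - s) 0 : ℝ) : ℂ) ^ m /
    ∏ j ∈ univ.erase k, ((x k : ℂ) - x j)) * Complex.exp (-(Complex.I * n * ξ) * s)) (n : ℝ)
  rw [hmain, Nat.abs_cast, Complex.real_smul, Complex.ofReal_natCast] at hscale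
  have hI : (-1 : ℂ) ^ (m + 1) / Complex.I ^ (m + 1) = Complex.I ^ (m + 1) := by
    rw [← div_pow]
    congr 1
    rw [div_eq_iff Complex.I_ne_zero, Complex.I_mul_I]
  calc _ = _ := ?_
    _ = _ := hscale
    _ = _ := ?_
  · refine integral_congr_ae (Filter.Eventually.of_forall fun t => ?_)
    simp only
    push_cast
    congr 2
    field_simp
  · simp only [neg_mul]
    rw [← mul_assoc]
    congr 1
    rw [← hI, mul_pow, mul_pow]
    field_simp
    ring
end
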